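/- arXiv:1908.10034 — 5 statements merged into one kernel-verified Lean document; each statement's English description precedes it below -/
import Mathlib

section
/- Let A be a centrally essential ring and suppose that the set B = {a ∈ A : ax = 0 for some nonzero x ∈ A} of all left zero-divisors of A is a two-sided ideal of A. Then B coincides with the set {a ∈ A : xa = 0 for some nonzero x ∈ A} of all right zero-divisors of A, B is completely prime (i.e., for all a, a' ∈ A with a ∉ B and a' ∉ B one has aa' ∉ B), and the quotient A/B is commutative (i.e., ab − ba ∈ B for all a, b ∈ A). -/
/-- A ring `A` is *centrally essential* if for every nonzero `a ∈ A` there exist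
nonzero central elements `c, d ∈ A` with `a * c = d`. -/
def IsCentrallyEssential (A : Type*) [Ring A] : Prop :=
  ∀ a : A, a ≠ 0 → ∃ c d : A, c ∈ Set.center A ∧ d ∈ Set.center A ∧
    c ≠ 0 ∧ d ≠ 0 ∧ a * c = d

/-- The set of left zero-divisors of a ring. -/
def leftZeroDivisors (A : Type*) [Ring A] : Set A :=
  {a : A | ∃ x : A, x ≠ 0 ∧ a * x = 0}

/-- The set of right zero-divisors of a ring. -/
def rightZeroDivisors (A : Type*) [Ring A] : Set A :=
  {a : A | ∃ x : A, x ≠ 0 ∧ x * a = 0}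

/-- In a centrally essential ring, left and right zero-divisors coincide. -/
theorem IsCentrallyEssential.leftZeroDivisors_eq_rightZeroDivisors {A : Type*} [Ring A]
    (hCE : IsCentrallyEssential A) : leftZeroDivisors A = rightZeroDivisors A := by
  ext a
  constructor
  · rintro ⟨x, hx, hax⟩
    obtain ⟨c, d, -, hd, -, hd0, rfl⟩ := hCE x hx
    refine ⟨x * c, hd0, ?_⟩
    rw [(Set.mem_center_iff.1 hd).comm a, ← mul_assoc, hax, zero_mul]
  · rintro ⟨x, hx, hxa⟩
    obtain ⟨c, d, hc, hd, -, hd0, rfl⟩ := hCE x hx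
    refine ⟨x * c, hd0, ?_⟩
    rw [← (Set.mem_center_iff.1 hd).comm a, mul_assoc, (Set.mem_center_iff.1 hc).comm a,
      ← mul_assoc, hxa, zero_mul]

/-- In any ring, a product of elements that are not left zero-divisors is not a left
zero-divisor. -/
theorem mul_notMem_leftZeroDivisors {A : Type*} [Ring A] {a b : A}
    (ha : a ∉ leftZeroDivisors A) (hb : b ∉ leftZeroDivisors A) :
    a * b ∉ leftZeroDivisors A := by
  rintro ⟨x, hx, h⟩
  exact ha ⟨b * x, fun hbx => hb ⟨x, hx, hbx⟩, by rw [← mul_assoc, h]⟩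

/-- In a centrally essential ring, every commutator is a left zero-divisor. -/
theorem IsCentrallyEssential.commutator_mem_leftZeroDivisors {A : Type*} [Ring A]
    [Nontrivial A] (hCE : IsCentrallyEssential A) (a b : A) :
    a * b - b * a ∈ leftZeroDivisors A := by
  rcases eq_or_ne a 0 with rfl | ha
  · exact ⟨1, one_ne_zero, by simp⟩
  · obtain ⟨c, d, hc, hd, hc0, -, rfl⟩ := hCE a ha
    refine ⟨c, hc0, ?_⟩
    rw [sub_mul, mul_assoc, ← (Set.mem_center_iff.1 hc).comm b, ← mul_assoc,
      (Set.mem_center_iff.1 hd).comm b, ← mul_assoc, sub_self]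

/-- Let `A` be a centrally essential ring and suppose that the set `B` of all left
zero-divisors of `A` is a two-sided ideal of `A`.  Then `B` coincides with the set of
all right zero-divisors of `A`, `B` is completely prime, and `A/B` is commutative. -/
theorem centrallyEssential_leftZeroDivisors_ideal {A : Type*} [Ring A] [Nontrivial A]
    (hCE : IsCentrallyEssential A)
    (B : TwoSidedIdeal A) (hB : (B : Set A) = leftZeroDivisors A) :
    (B : Set A) = rightZeroDivisors A ∧
    (∀ a a' : A, a ∉ B → a' ∉ B → a * a' ∉ B) ∧
    (∀ a b : A, a * b - b * a ∈ B) := by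
  have mem_iff (a : A) : a ∈ B ↔ a ∈ leftZeroDivisors A := by
    rw [← hB, SetLike.mem_coe]
  simp only [mem_iff]
  exact ⟨hB.trans hCE.leftZeroDivisors_eq_rightZeroDivisors,
    fun _ _ => mul_notMem_leftZeroDivisors, hCE.commutator_mem_leftZeroDivisors⟩
end

section
/- Let A be a centrally essential ring such that the set B of all left zero-divisors of A is a two-sided ideal of A, and suppose that B is nilpotent of nilpotence index n+1 (i.e., B^{n+1} = 0 and B^n ≠ 0). Then the ideal B^n is contained in the center of A. -/
/-- The set of all products of `k` elements of `B`. -/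
def setProducts {A : Type*} [Ring A] (B : Set A) (k : ℕ) : Set A :=
  {x : A | ∃ l : List A, l.length = k ∧ (∀ a ∈ l, a ∈ B) ∧ l.prod = x}

/-- The `k`-th power of a two-sided ideal `B`: the two-sided ideal generated by all
products of `k` elements of `B`. -/
def idealPow {A : Type*} [Ring A] (B : TwoSidedIdeal A) (k : ℕ) : TwoSidedIdeal A :=
  TwoSidedIdeal.span (setProducts (B : Set A) k)

/-- A central element `c` of `B` annihilates `B ^ n` as soon as `B ^ (n + 1) = 0`. -/
theorem mul_eq_zero_of_mem_idealPow {A : Type*} [Ring A] {B : TwoSidedIdeal A} {n : ℕ}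
    (hnil : idealPow B (n + 1) = ⊥) {c x : A} (hcB : c ∈ B) (hc : c ∈ Set.center A)
    (hx : x ∈ idealPow B n) : x * c = 0 := by
  have comm : ∀ r : A, c * r = r * c := fun r => hc.comm r
  let ann : TwoSidedIdeal A := TwoSidedIdeal.mk' {y | y * c = 0} (zero_mul c)
    (fun {y z} (hy : y * c = 0) (hz : z * c = 0) =>
      show (y + z) * c = 0 by rw [add_mul, hy, hz, add_zero])
    (fun {y} (hy : y * c = 0) => show -y * c = 0 by rw [neg_mul, hy, neg_zero])
    (fun {r y} (hy : y * c = 0) => show r * y * c = 0 by rw [mul_assoc, hy, mul_zero])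
    (fun {y r} (hy : y * c = 0) => show y * r * c = 0 by
      rw [mul_assoc, ← comm, ← mul_assoc, hy, zero_mul])
  have mem_ann : ∀ y, y ∈ ann ↔ y * c = 0 := fun y => TwoSidedIdeal.mem_mk' ..
  suffices h : idealPow B n ≤ ann from (mem_ann x).1 (h hx)
  refine TwoSidedIdeal.span_le.2 ?_
  rintro _ ⟨l, hl, hlB, rfl⟩
  refine (mem_ann _).2 ?_
  have hmem : l.prod * c ∈ idealPow B (n + 1) := by
    refine TwoSidedIdeal.subset_span ⟨l ++ [c], by simp [hl], fun a ha => ?_, by simp⟩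
    rcases List.mem_append.1 ha with ha | ha
    · exact hlB a ha
    · rw [List.mem_singleton.1 ha]
      exact hcB
  rwa [hnil, TwoSidedIdeal.mem_bot] at hmem

/-- Let `A` be a centrally essential ring such that the set `B` of all left zero-divisors
of `A` is a two-sided ideal of `A`, and suppose that `B` is nilpotent of nilpotence index
`n + 1` (i.e. `B ^ (n + 1) = 0` and `B ^ n ≠ 0`).  Then the ideal `B ^ n` is contained in
the center of `A`. -/
theorem idealPow_subset_center_of_nilpotent {A : Type*} [Ring A] [Nontrivial A]
    (hCE : IsCentrallyEssential A)
    (B : TwoSidedIdeal A) (hB : (B : Set A) = leftZeroDivisors A)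
    (n : ℕ) (hnil : idealPow B (n + 1) = ⊥) (hne : idealPow B n ≠ ⊥) :
    (idealPow B n : Set A) ⊆ Set.center A := by
  intro x hx
  by_cases hx0 : x = 0
  · rw [hx0]
    exact Set.zero_mem_center
  obtain ⟨c, d, hc, hd, -, hd0, hxc⟩ := hCE x hx0
  have hcB : c ∉ leftZeroDivisors A := by
    rw [← hB]
    exact fun h => hd0 (hxc ▸ mul_eq_zero_of_mem_idealPow hnil h hc hx)
  refine Semigroup.mem_center_iff.2 fun a => ?_
  by_contra hax
  refine hcB ⟨a * x - x * a, sub_ne_zero.2 hax, ?_⟩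
  rw [hc.comm, sub_mul, mul_assoc, mul_assoc, hxc, ← hc.comm a, ← mul_assoc, hxc, hd.comm a,
    sub_self]
end

section
/- Let A be a commutative integral domain and let M be a nonzero finitely generated torsion-free A-module which is divisible (i.e., for every nonzero a ∈ A and every m ∈ M there exists m' ∈ M with a·m' = m). Then A is a field. -/
/-- Let `A` be a commutative integral domain and let `M` be a nonzero finitely generated
torsion-free `A`-module which is divisible.  Then `A` is a field. -/
theorem isField_of_divisible_torsionFree_fg {A : Type*} {M : Type*}
    [CommRing A] [IsDomain A] [AddCommGroup M] [Module A M] [Module.Finite A M]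
    (hM : ∃ m : M, m ≠ 0)
    (htf : ∀ (a : A) (m : M), a • m = 0 → a = 0 ∨ m = 0)
    (hdiv : ∀ a : A, a ≠ 0 → ∀ m : M, ∃ m' : M, a • m' = m) :
    IsField A := by
  obtain ⟨m, hm⟩ := hM
  refine ⟨exists_pair_ne A, mul_comm, fun {a} ha ↦ ?_⟩
  have hle : (⊤ : Submodule A M) ≤ Ideal.span {a} • ⊤ := by
    intro x _
    obtain ⟨y, rfl⟩ := hdiv a ha x
    exact Submodule.smul_mem_smul (Ideal.mem_span_singleton_self a) Submodule.mem_top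
  obtain ⟨r, hr, hrM⟩ := Submodule.exists_sub_one_mem_and_smul_eq_zero_of_fg_of_le_smul
    (Ideal.span {a}) ⊤ Module.Finite.fg_top hle
  obtain rfl : r = 0 := (htf r m (hrM m Submodule.mem_top)).resolve_right hm
  obtain ⟨c, hc⟩ := Ideal.mem_span_singleton.mp hr
  exact ⟨-c, by linear_combination hc⟩
end

section
/- Let A be a centrally essential, right distributive ring, and let B be the set of all left zero-divisors of A. Suppose B is a two-sided ideal of A which is nonzero, nilpotent, finitely generated as a right ideal, and satisfies B = aB for every element a ∈ A \ B. Then A is a uniserial (left and right) Artinian ring whose Jacobson radical equals B. -/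
/-- A ring is *right distributive* if the lattice of its right ideals is distributive. -/
def IsRightDistributive (A : Type*) [Ring A] : Prop :=
  ∀ I J K : Submodule Aᵐᵒᵖ A, I ⊓ (J ⊔ K) = (I ⊓ J) ⊔ (I ⊓ K)

/-- A ring is *uniserial* if its right ideals are totally ordered by inclusion and its
left ideals are totally ordered by inclusion. -/
def IsUniserialRing (A : Type*) [Ring A] : Prop :=
  (∀ I J : Submodule Aᵐᵒᵖ A, I ≤ J ∨ J ≤ I) ∧ (∀ I J : Ideal A, I ≤ J ∨ J ≤ I)

/-- A ring is *Artinian* if it is both left and right Artinian. -/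
def IsArtinianBothSides (A : Type*) [Ring A] : Prop :=
  IsArtinian A A ∧ IsArtinian Aᵐᵒᵖ A

open scoped Pointwise in
/-- The right ideal spanned by all `k`-fold products of elements of `S`. -/
def rightSpanPow {A : Type*} [Ring A] (S : Set A) (k : ℕ) : Submodule Aᵐᵒᵖ A :=
  Submodule.span Aᵐᵒᵖ (S ^ k)

section RightSpanPow

open scoped Pointwise

variable {A : Type*} [Ring A] {S : Set A}

theorem rightSpanPow_succ_le {k : ℕ} {Q : Submodule Aᵐᵒᵖ A}
    (h : ∀ s ∈ S, ∀ x ∈ rightSpanPow S k, s * x ∈ Q) : rightSpanPow S (k + 1) ≤ Q := by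
  refine Submodule.span_le.2 fun x hx => ?_
  rw [pow_succ'] at hx
  obtain ⟨s, hs, t, ht, rfl⟩ := Set.mem_mul.1 hx
  exact h s hs t (Submodule.subset_span ht)

theorem mul_mem_rightSpanPow_succ_of_mem {k : ℕ} {s x : A} (hs : s ∈ S)
    (hx : x ∈ rightSpanPow S k) : s * x ∈ rightSpanPow S (k + 1) := by
  refine Submodule.span_induction (p := fun x _ => s * x ∈ rightSpanPow S (k + 1))
    ?_ ?_ ?_ ?_ hx
  · intro t ht
    refine Submodule.subset_span ?_
    rw [pow_succ']
    exact Set.mul_mem_mul hs ht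
  · simp
  · intro y z _ _ hy hz
    rw [mul_add]
    exact add_mem hy hz
  · intro r y _ hy
    rw [mul_smul_comm]
    exact Submodule.smul_mem _ r hy

theorem mul_mem_rightSpanPow_succ_of_mem_span {k : ℕ}
    (hk : ∀ r : A, ∀ x ∈ rightSpanPow S k, r * x ∈ rightSpanPow S k)
    {y : A} (hy : y ∈ Submodule.span Aᵐᵒᵖ S) :
    ∀ x ∈ rightSpanPow S k, y * x ∈ rightSpanPow S (k + 1) := by
  refine Submodule.span_induction
    (p := fun y _ => ∀ x ∈ rightSpanPow S k, y * x ∈ rightSpanPow S (k + 1)) ?_ ?_ ?_ ?_ hy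
  · exact fun s hs x hx => mul_mem_rightSpanPow_succ_of_mem hs hx
  · simp
  · intro y z _ _ hy hz x hx
    rw [add_mul]
    exact add_mem (hy x hx) (hz x hx)
  · intro r y _ hy x hx
    rw [MulOpposite.smul_eq_mul_unop, mul_assoc]
    exact hy _ (hk _ x hx)

theorem mem_rightSpanPow_zero (x : A) : x ∈ rightSpanPow S 0 := by
  rw [rightSpanPow, pow_zero, ← Set.singleton_one, Submodule.mem_span_singleton]
  exact ⟨MulOpposite.op x, by simp⟩

theorem rightSpanPow_one : rightSpanPow S 1 = Submodule.span Aᵐᵒᵖ S := by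
  rw [rightSpanPow, pow_one]

theorem mul_mem_rightSpanPow
    (hS : ∀ r : A, ∀ y ∈ Submodule.span Aᵐᵒᵖ S, r * y ∈ Submodule.span Aᵐᵒᵖ S)
    (k : ℕ) : ∀ r : A, ∀ x ∈ rightSpanPow S k, r * x ∈ rightSpanPow S k := by
  induction k with
  | zero => exact fun r x _ => mem_rightSpanPow_zero _
  | succ k ih =>
    intro r
    let Q : Submodule Aᵐᵒᵖ A :=
      { carrier := {x | r * x ∈ rightSpanPow S (k + 1)}
        add_mem' := fun {x y} hx hy => by
          simp only [Set.mem_ofPred_eq, mul_add]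
          exact add_mem hx hy
        zero_mem' := by simp
        smul_mem' := fun c x hx => by
          simp only [Set.mem_ofPred_eq, mul_smul_comm]
          exact Submodule.smul_mem _ c hx }
    refine fun x hx => rightSpanPow_succ_le (Q := Q) (fun s hs x hx => ?_) hx
    change r * (s * x) ∈ rightSpanPow S (k + 1)
    rw [← mul_assoc]
    exact mul_mem_rightSpanPow_succ_of_mem_span ih (hS r s (Submodule.subset_span hs)) x hx

theorem mul_mem_rightSpanPow_succ_right {y : A} (hy : y ∈ Submodule.span Aᵐᵒᵖ S)
    (hS : ∀ r : A, ∀ y ∈ Submodule.span Aᵐᵒᵖ S, r * y ∈ Submodule.span Aᵐᵒᵖ S)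
    (k : ℕ) : ∀ x ∈ rightSpanPow S k, x * y ∈ rightSpanPow S (k + 1) := by
  induction k with
  | zero =>
    intro x _
    rw [zero_add, rightSpanPow_one]
    exact hS x y hy
  | succ k ih =>
    let Q : Submodule Aᵐᵒᵖ A :=
      { carrier := {x | ∀ r : A, x * (r * y) ∈ rightSpanPow S (k + 1 + 1)}
        add_mem' := fun {x z} hx hz r => by
          rw [add_mul]
          exact add_mem (hx r) (hz r)
        zero_mem' := by simp
        smul_mem' := fun c x hx r => by
          rw [MulOpposite.smul_eq_mul_unop, mul_assoc, ← mul_assoc _ r]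
          exact hx _ }
    intro x hx
    have := rightSpanPow_succ_le (Q := Q) (fun s hs x hx r => ?_) hx 1
    · simpa using this
    · rw [mul_assoc s, ← mul_assoc x]
      exact mul_mem_rightSpanPow_succ_of_mem hs
        (ih _ (Submodule.smul_mem _ (MulOpposite.op r) hx))

theorem exists_mul_eq_of_mem_rightSpanPow_succ {a : A}
    (hS : ∀ r : A, ∀ y ∈ Submodule.span Aᵐᵒᵖ S, r * y ∈ Submodule.span Aᵐᵒᵖ S)
    (ha : ∀ y ∈ S, ∃ z ∈ Submodule.span Aᵐᵒᵖ S, a * z = y) (k : ℕ) :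
    ∀ x ∈ rightSpanPow S (k + 1), ∃ z ∈ rightSpanPow S (k + 1), a * z = x := by
  let Q : Submodule Aᵐᵒᵖ A :=
    { carrier := {x | ∃ z ∈ rightSpanPow S (k + 1), a * z = x}
      add_mem' := by
        rintro _ _ ⟨x, hx, rfl⟩ ⟨y, hy, rfl⟩
        exact ⟨x + y, add_mem hx hy, mul_add _ _ _⟩
      zero_mem' := ⟨0, zero_mem _, mul_zero _⟩
      smul_mem' := by
        rintro c _ ⟨x, hx, rfl⟩
        exact ⟨c • x, Submodule.smul_mem _ c hx, mul_smul_comm _ _ _⟩ }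
  refine fun x hx => rightSpanPow_succ_le (Q := Q) (fun s hs x hx => ?_) hx
  obtain ⟨z, hz, rfl⟩ := ha s hs
  exact ⟨z * x, mul_mem_rightSpanPow_succ_of_mem_span (mul_mem_rightSpanPow hS k) hz x hx,
    (mul_assoc _ _ _).symm⟩

theorem rightSpanPow_eq_bot {k : ℕ}
    (h : ∀ l : List A, l.length = k → (∀ a ∈ l, a ∈ S) → l.prod = 0) :
    rightSpanPow S k = ⊥ := by
  rw [rightSpanPow, Submodule.span_eq_bot]
  intro x hx
  obtain ⟨f, rfl⟩ := Set.mem_pow.1 hx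
  refine h _ (by simp) fun a ha => ?_
  obtain ⟨i, rfl⟩ := List.mem_ofFn.1 ha
  exact (f i).2

theorem rightSpanPow_fg (hS : S.Finite) (k : ℕ) : (rightSpanPow S k).FG := by
  refine Submodule.fg_span ?_
  induction k with
  | zero => simp
  | succ k ih => exact pow_succ S k ▸ ih.mul hS

end RightSpanPow

/-- In a right distributive ring any two elements are comparable up to a partition of unity. -/
theorem IsRightDistributive.exists_add_eq_one {A : Type*} [Ring A]
    (h : IsRightDistributive A) (a b : A) :
    ∃ u v : A, u + v = 1 ∧ (∃ r, a * u = b * r) ∧ ∃ r, b * v = a * r := by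
  have ha : a ∈ Submodule.span Aᵐᵒᵖ {a} ⊓
      (Submodule.span Aᵐᵒᵖ {b} ⊔ Submodule.span Aᵐᵒᵖ {a - b}) := by
    refine ⟨Submodule.mem_span_singleton_self a, Submodule.mem_sup.2
      ⟨b, Submodule.mem_span_singleton_self b, a - b,
        Submodule.mem_span_singleton_self _, by abel⟩⟩
  rw [h] at ha
  obtain ⟨x, ⟨-, hx⟩, y, ⟨hy', hy⟩, hxy⟩ := Submodule.mem_sup.1 ha
  obtain ⟨p, rfl⟩ := Submodule.mem_span_singleton.1 hx
  obtain ⟨q, rfl⟩ := Submodule.mem_span_singleton.1 hy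
  obtain ⟨q', hq'⟩ := Submodule.mem_span_singleton.1 hy'
  simp only [MulOpposite.smul_eq_mul_unop] at *
  refine ⟨1 - q.unop, q.unop, by abel, ⟨p.unop - q.unop, ?_⟩, ⟨q.unop - q'.unop, ?_⟩⟩
  · rw [mul_sub, mul_one, mul_sub]
    nth_rw 1 [← hxy]
    rw [sub_mul]
    abel
  · rw [mul_sub, hq', sub_mul]
    abel

section Chain

variable {R M : Type*} [Ring R] [AddCommGroup M] [Module R M] {p : ℕ → Submodule R M} {n : ℕ}

theorem Submodule.exists_eq_of_span_singleton_eq (hp : Antitone p) (hn : p n = ⊥)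
    (h : ∀ x, ∃ k, Submodule.span R {x} = p k) (N : Submodule R M) : ∃ k ≤ n, N = p k := by
  classical
  have hex : ∃ k, p k ≤ N := ⟨n, hn ▸ bot_le⟩
  refine ⟨Nat.find hex, Nat.find_min' hex (hn ▸ bot_le),
    le_antisymm (fun x hx => ?_) (Nat.find_spec hex)⟩
  obtain ⟨j, hj⟩ := h x
  have hxN : p j ≤ N := hj ▸ (Submodule.span_singleton_le_iff_mem x N).2 hx
  exact hp (Nat.find_min' hex hxN) (hj ▸ Submodule.mem_span_singleton_self x)

theorem Submodule.le_total_and_isArtinian_of_span_singleton_eq (hp : Antitone p) (hn : p n = ⊥)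
    (h : ∀ x, ∃ k, Submodule.span R {x} = p k) :
    (∀ I J : Submodule R M, I ≤ J ∨ J ≤ I) ∧ IsArtinian R M := by
  have key := Submodule.exists_eq_of_span_singleton_eq hp hn h
  constructor
  · intro I J
    obtain ⟨i, -, rfl⟩ := key I
    obtain ⟨j, -, rfl⟩ := key J
    exact (le_total j i).imp (fun h => hp h) (fun h => hp h)
  · have : Finite (Submodule R M) := by
      refine Finite.of_surjective (fun k : Fin (n + 1) => p k) fun N => ?_
      obtain ⟨k, hk, rfl⟩ := key N
      exact ⟨⟨k, by omega⟩, rfl⟩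
    exact ⟨wellFounded_lt⟩

end Chain

section NilpotentGenerator

variable {A : Type*} [Ring A] {b : A} {n : ℕ}

theorem left_le_total_and_isArtinian (hb : b ^ n = 0)
    (h : ∀ x : A, IsUnit x ∨ ∃ y, x = y * b) :
    (∀ I J : Ideal A, I ≤ J ∨ J ≤ I) ∧ IsArtinian A A := by
  refine Submodule.le_total_and_isArtinian_of_span_singleton_eq
    (p := fun k => Submodule.span A {b ^ k}) (n := n) ?_ (by simp [hb]) fun x => ?_
  · refine antitone_nat_of_succ_le fun k => ?_
    rw [Submodule.span_singleton_le_iff_mem, Submodule.mem_span_singleton]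
    exact ⟨b, by rw [smul_eq_mul, pow_succ']⟩
  · have key : ∀ k, (∃ y, x = y * b ^ k) ∨ ∃ j, ∃ u : Aˣ, x = u * b ^ j := by
      intro k
      induction k with
      | zero => exact Or.inl ⟨x, by simp⟩
      | succ k ih =>
        rcases ih with ⟨y, rfl⟩ | ih
        · rcases h y with ⟨u, rfl⟩ | ⟨z, rfl⟩
          · exact Or.inr ⟨k, u, rfl⟩
          · exact Or.inl ⟨z, by rw [mul_assoc, pow_succ']⟩
        · exact Or.inr ih
    rcases key n with ⟨y, rfl⟩ | ⟨j, u, rfl⟩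
    · exact ⟨n, by simp [hb]⟩
    · exact ⟨j, Submodule.span_singleton_group_smul_eq A u (b ^ j)⟩

theorem right_le_total_and_isArtinian (hb : b ^ n = 0)
    (h : ∀ x : A, IsUnit x ∨ ∃ y, x = b * y) :
    (∀ I J : Submodule Aᵐᵒᵖ A, I ≤ J ∨ J ≤ I) ∧ IsArtinian Aᵐᵒᵖ A := by
  refine Submodule.le_total_and_isArtinian_of_span_singleton_eq
    (p := fun k => Submodule.span Aᵐᵒᵖ {b ^ k}) (n := n) ?_ (by simp [hb]) fun x => ?_
  · refine antitone_nat_of_succ_le fun k => ?_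
    rw [Submodule.span_singleton_le_iff_mem, Submodule.mem_span_singleton]
    exact ⟨MulOpposite.op b, by rw [op_smul_eq_mul, pow_succ]⟩
  · have key : ∀ k, (∃ y, x = b ^ k * y) ∨ ∃ j, ∃ u : Aˣ, x = b ^ j * u := by
      intro k
      induction k with
      | zero => exact Or.inl ⟨x, by simp⟩
      | succ k ih =>
        rcases ih with ⟨y, rfl⟩ | ih
        · rcases h y with ⟨u, rfl⟩ | ⟨z, rfl⟩
          · exact Or.inr ⟨k, u, rfl⟩
          · exact Or.inl ⟨z, by rw [← mul_assoc, pow_succ]⟩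
        · exact Or.inr ih
    rcases key n with ⟨y, rfl⟩ | ⟨j, u, rfl⟩
    · exact ⟨n, by simp [hb]⟩
    · exact ⟨j, Submodule.span_singleton_group_smul_eq Aᵐᵒᵖ (Units.opEquiv.symm
        (MulOpposite.op u)) (b ^ j)⟩

/-- If `b ^ (n + 2) = 0` while `b ^ (n + 1)` is a nonzero central element, then a generator `b`
of the maximal ideal as a right ideal also generates it as a left ideal. -/
theorem exists_mul_eq_mul_of_pow_central (hb : b ^ (n + 2) = 0) (hb' : b ^ (n + 1) ≠ 0)
    (hcen : ∀ a, a * b ^ (n + 1) = b ^ (n + 1) * a)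
    (h : ∀ x : A, IsUnit x ∨ ∃ y, x = b * y) (hl : ∀ a, ∃ y, a * b = b * y) (t : A) :
    ∃ s, b * t = s * b := by
  have iter : ∀ (k : ℕ) (a : A), ∃ s s', a * b ^ k = b ^ k * s ∧ s * b = b * s' := by
    intro k a
    induction k with
    | zero =>
      obtain ⟨y, hy⟩ := hl a
      exact ⟨a, y, by simp, hy⟩
    | succ k ih =>
      obtain ⟨s, s', h₁, h₂⟩ := ih
      obtain ⟨y, hy⟩ := hl s'
      exact ⟨s', y, by rw [pow_succ, ← mul_assoc, h₁, mul_assoc, h₂, ← mul_assoc], hy⟩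
  have hmod : ∀ t, ∃ s r, b * t = s * b + b ^ 2 * r := by
    intro t
    obtain ⟨s, s', h₁, h₂⟩ := iter n t
    have h₃ : b ^ (n + 1) * (t - s') = 0 := by
      rw [mul_sub, ← hcen, pow_succ, ← mul_assoc, h₁, mul_assoc, h₂, mul_assoc, sub_self]
    rcases h (t - s') with hu | ⟨r, hr⟩
    · exact absurd (hu.mul_left_eq_zero.1 h₃) hb'
    · refine ⟨s, r, ?_⟩
      rw [h₂, pow_two, mul_assoc, ← hr, mul_sub]
      abel
  have hpow : ∀ k, ∃ s r, b * t = s * b + b ^ (k + 2) * r := by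
    intro k
    induction k with
    | zero => exact hmod t
    | succ k ih =>
      obtain ⟨s, r, hsr⟩ := ih
      obtain ⟨s', r', hsr'⟩ := hmod r
      refine ⟨s + b ^ (k + 1) * s', r', ?_⟩
      rw [hsr, pow_succ, mul_assoc, hsr']
      simp only [mul_add, add_mul, ← mul_assoc, ← pow_add, add_assoc]
  obtain ⟨s, r, hsr⟩ := hpow n
  exact ⟨s, by rw [hsr, hb, zero_mul, add_zero]⟩

end NilpotentGenerator

section CentrallyEssential

variable {A : Type*} [Ring A] {B : TwoSidedIdeal A}

theorem mem_iff_of_eq_leftZeroDivisors (hB : (B : Set A) = leftZeroDivisors A) {a : A} :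
    a ∈ B ↔ ∃ x : A, x ≠ 0 ∧ a * x = 0 := by
  rw [← SetLike.mem_coe, hB]
  rfl

theorem commutator_mem_of_centrallyEssential [Nontrivial A] (hCE : IsCentrallyEssential A)
    (hB : (B : Set A) = leftZeroDivisors A) (a x : A) : a * x - x * a ∈ B := by
  rw [mem_iff_of_eq_leftZeroDivisors hB]
  rcases eq_or_ne a 0 with rfl | ha
  · exact ⟨1, one_ne_zero, by simp⟩
  obtain ⟨c, d, hc, hd, hc0, -, rfl⟩ := hCE a ha
  rw [Semigroup.mem_center_iff] at hc hd
  refine ⟨c, hc0, ?_⟩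
  rw [sub_mul, mul_assoc a, hc x, ← mul_assoc, mul_assoc x, hd x, sub_self]

/-- The quotient by `B` is a field, provided there is a nonzero finitely generated right ideal
annihilated by `B` on both sides on which all `a ∉ B` act surjectively from the left. -/
theorem isUnit_of_notMem [Nontrivial A] (hCE : IsCentrallyEssential A)
    (hdist : IsRightDistributive A) (hB : (B : Set A) = leftZeroDivisors A)
    (hnil : ∀ y ∈ B, IsNilpotent y) {N : Submodule Aᵐᵒᵖ A} (hN : N ≠ ⊥) (hfg : N.FG)
    (hBN : ∀ y ∈ B, ∀ x ∈ N, y * x = 0) (hNB : ∀ y ∈ B, ∀ x ∈ N, x * y = 0)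
    (hdiv : ∀ a ∉ B, ∀ x ∈ N, ∃ z ∈ N, a * z = x) {a : A} (ha : a ∉ B) : IsUnit a := by
  have hmem := fun a => mem_iff_of_eq_leftZeroDivisors hB (a := a)
  have hcomm := commutator_mem_of_centrallyEssential hCE hB
  have hreg : ∀ a ∉ B, ∀ x, a * x = 0 → x = 0 := by
    intro a ha x hx
    by_contra h
    exact ha ((hmem a).2 ⟨x, h, hx⟩)
  have hmul : ∀ a ∉ B, ∀ b ∉ B, a * b ∉ B := by
    intro a ha b hb hab
    obtain ⟨x, hx, h⟩ := (hmem _).1 hab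
    exact hx (hreg b hb x (hreg a ha _ (by rw [← mul_assoc, h])))
  have hone : (1 : A) ∉ B := fun h => by
    obtain ⟨x, hx, h⟩ := (hmem _).1 h
    exact hx (by simpa using h)
  -- a nonzero central element of `N`
  obtain ⟨d, hdN, hd0, hd⟩ : ∃ d ∈ N, d ≠ 0 ∧ ∀ g, g * d = d * g := by
    obtain ⟨x, hx, hx0⟩ := N.exists_mem_ne_zero_of_ne_bot hN
    obtain ⟨c, d, -, hd, -, hd0, rfl⟩ := hCE x hx0
    exact ⟨x * c, N.smul_mem (MulOpposite.op c) hx, hd0, Semigroup.mem_center_iff.1 hd⟩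
  have hcen : ∀ v ∉ B, ∀ z ∈ N, v * z = d → ∀ y, y * z = z * y := by
    intro v hv z hz hvz y
    rw [← sub_eq_zero]
    refine hreg v hv _ ?_
    have h₁ := hBN _ (hcomm v y) z hz
    rw [sub_mul, sub_eq_zero, mul_assoc y, hvz, hd] at h₁
    rw [mul_sub, ← mul_assoc, h₁, ← mul_assoc, hvz, sub_self]
  have hrank : ∀ x ∈ N, ∃ w ∉ B, ∃ r, x * w = d * r := by
    intro x hx
    obtain ⟨u, v, huv, hu, t, ht⟩ := hdist.exists_add_eq_one x d
    by_cases huB : u ∈ B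
    · have hvB : v ∉ B := fun hvB => hone (huv ▸ B.add_mem huB hvB)
      refine ⟨t, fun htB => hd0 (hreg v hvB d ?_), v, ht.symm⟩
      rw [hd, ht, hNB t htB x hx]
    · exact ⟨u, huB, hu⟩
  obtain ⟨w, hwB, hw⟩ : ∃ w ∉ B, ∀ x ∈ N, ∃ r, x * w = d * r := by
    obtain ⟨T, rfl⟩ := hfg
    have hT : ∀ T' : Finset A, T' ⊆ T → ∃ w ∉ B, ∀ x ∈ T', ∃ r, x * w = d * r := by
      classical
      intro T'
      induction T' using Finset.induction_on with
      | empty => exact fun _ => ⟨1, hone, by simp⟩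
      | insert x T' _ ih =>
        intro hsub
        obtain ⟨w, hwB, hw⟩ := ih ((Finset.subset_insert _ _).trans hsub)
        obtain ⟨w', hwB', r, hr⟩ :=
          hrank x (Submodule.subset_span (hsub (Finset.mem_insert_self _ _)))
        refine ⟨w * w', hmul _ hwB _ hwB', fun y hy => ?_⟩
        have hyN := Submodule.subset_span (R := Aᵐᵒᵖ) (Finset.mem_coe.2 (hsub hy))
        rcases Finset.mem_insert.1 hy with rfl | hy
        · refine ⟨r * w, ?_⟩
          have h₁ := hNB _ (hcomm w w') y hyN
          rw [mul_sub, sub_eq_zero] at h₁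
          rw [h₁, ← mul_assoc, hr, mul_assoc]
        · obtain ⟨s, hs⟩ := hw y hy
          exact ⟨s * w', by rw [← mul_assoc, hs, mul_assoc]⟩
    obtain ⟨w, hwB, hw⟩ := hT T subset_rfl
    refine ⟨w, hwB, fun x hx => ?_⟩
    refine Submodule.span_induction (p := fun x _ => ∃ r, x * w = d * r) ?_ ?_ ?_ ?_ hx
    · exact hw
    · exact ⟨0, by simp⟩
    · rintro x y _ _ ⟨r, hr⟩ ⟨s, hs⟩
      exact ⟨r + s, by rw [add_mul, hr, hs, mul_add]⟩
    · rintro c x hx ⟨r, hr⟩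
      refine ⟨r * c.unop, ?_⟩
      have h₁ := hNB _ (hcomm c.unop w) x hx
      rw [mul_sub, sub_eq_zero] at h₁
      rw [MulOpposite.smul_eq_mul_unop, mul_assoc, h₁, ← mul_assoc, hr, mul_assoc]
  have hright : ∀ a ∉ B, ∃ r, a * r = 1 := by
    intro a ha
    obtain ⟨z, hz, hzd⟩ := hdiv (a * w) (hmul a ha w hwB) d hdN
    obtain ⟨r, hr⟩ := hw z hz
    rw [← hcen _ (hmul a ha w hwB) z hz hzd] at hr
    have h₁ : (1 - a * r) * d = 0 := by
      rw [sub_mul, one_mul, mul_assoc, hd r, ← hr, ← mul_assoc, hzd, sub_self]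
    obtain ⟨u, hu⟩ := (hnil _ ((hmem _).2 ⟨d, hd0, h₁⟩)).isUnit_one_sub
    rw [sub_sub_cancel] at hu
    exact ⟨r * ↑u⁻¹, by rw [← mul_assoc, ← hu, u.mul_inv]⟩
  obtain ⟨r, hr⟩ := hright a ha
  have hrB : r ∉ B := fun h => hone (hr ▸ B.mul_mem_left a r h)
  obtain ⟨s, hs⟩ := hright r hrB
  have has : a = s := left_inv_eq_right_inv hr hs
  exact ⟨⟨a, r, hr, has ▸ hs⟩, rfl⟩

end CentrallyEssential

/-- Let `A` be a centrally essential right distributive ring and let `B`, the set of all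
left zero-divisors of `A`, be a two-sided ideal which is nonzero, nilpotent, finitely
generated as a right ideal and satisfies `B = aB` for all `a ∈ A \ B`.  Then `A` is a
uniserial Artinian ring whose Jacobson radical equals `B`. -/
theorem uniserial_artinian_of_centrallyEssential_distributive {A : Type*} [Ring A]
    [Nontrivial A]
    (hCE : IsCentrallyEssential A) (hdist : IsRightDistributive A)
    (B : TwoSidedIdeal A) (hB : (B : Set A) = leftZeroDivisors A)
    (hne : B ≠ ⊥)
    (hnil : ∃ k : ℕ, ∀ l : List A, l.length = k → (∀ a ∈ l, a ∈ B) → l.prod = 0)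
    (hfg : ∃ S : Finset A, (Submodule.span Aᵐᵒᵖ (S : Set A) : Set A) = (B : Set A))
    (haB : ∀ a : A, a ∉ B → (B : Set A) = (fun x => a * x) '' (B : Set A)) :
    IsUniserialRing A ∧ IsArtinianBothSides A ∧
      (((⊥ : Ideal A).jacobson : Set A) = (B : Set A)) := by
  have hmem := fun a => mem_iff_of_eq_leftZeroDivisors hB (a := a)
  obtain ⟨m, hm⟩ := hnil
  obtain ⟨S, hS⟩ := hfg
  have hspan : ∀ x, x ∈ Submodule.span Aᵐᵒᵖ (S : Set A) ↔ x ∈ B := fun x => by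
    rw [← SetLike.mem_coe, hS, SetLike.mem_coe]
  have hSl : ∀ r : A, ∀ y ∈ Submodule.span Aᵐᵒᵖ (S : Set A),
      r * y ∈ Submodule.span Aᵐᵒᵖ (S : Set A) := fun r y hy => by
    rw [hspan] at hy ⊢
    exact B.mul_mem_left r y hy
  have hBnil : ∀ y ∈ B, IsNilpotent y := fun y hy =>
    ⟨m, by
      rw [← List.prod_replicate]
      exact hm _ (by simp) fun a ha => (List.eq_of_mem_replicate ha) ▸ hy⟩
  obtain ⟨b₀, hb₀B, hb₀⟩ : ∃ b ∈ B, b ≠ 0 := by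
    by_contra! h
    exact hne (le_bot_iff.1 fun x hx => (TwoSidedIdeal.mem_bot A).2 (h x hx))
  have hone : (1 : A) ∉ B := fun h => by
    obtain ⟨x, hx, h⟩ := (hmem _).1 h
    exact hx (by simpa using h)
  -- the last nonzero power of `B`
  obtain ⟨n, hn, hn'⟩ : ∃ n, rightSpanPow (S : Set A) (n + 1) ≠ ⊥ ∧
      rightSpanPow (S : Set A) (n + 1 + 1) = ⊥ := by
    by_contra! h
    have hall : ∀ k, rightSpanPow (S : Set A) (k + 1) ≠ ⊥ := by
      intro k
      induction k with
      | zero =>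
        intro h0
        rw [zero_add, rightSpanPow_one] at h0
        have := (hspan b₀).2 hb₀B
        rw [h0] at this
        exact hb₀ ((Submodule.mem_bot _).1 this)
      | succ k ih => exact h k ih
    refine hall m (le_bot_iff.1 (rightSpanPow_succ_le fun s _ x hx => ?_))
    rw [rightSpanPow_eq_bot fun l hl hlS =>
      hm l hl fun a ha => (hspan a).1 (Submodule.subset_span (hlS a ha)), Submodule.mem_bot] at hx
    simp [hx]
  have hunit : ∀ a ∉ B, IsUnit a := fun a ha =>
    isUnit_of_notMem hCE hdist hB hBnil hn
      (rightSpanPow_fg S.finite_toSet (n + 1))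
      (fun y hy x hx => by
        have := mul_mem_rightSpanPow_succ_of_mem_span (mul_mem_rightSpanPow hSl _)
          ((hspan y).2 hy) x hx
        rwa [hn', Submodule.mem_bot] at this)
      (fun y hy x hx => by
        have := mul_mem_rightSpanPow_succ_right ((hspan y).2 hy) hSl _ x hx
        rwa [hn', Submodule.mem_bot] at this)
      (fun a ha => exists_mul_eq_of_mem_rightSpanPow_succ hSl (fun y hy => by
        have hyB : y ∈ (B : Set A) := (hspan y).1 (Submodule.subset_span hy)
        rw [haB a ha] at hyB
        obtain ⟨z, hz, hzy⟩ := hyB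
        exact ⟨z, (hspan z).2 hz, hzy⟩) n) ha
  -- `B` is a principal right ideal
  have hcomp : ∀ x y : A, (∃ r, x = y * r) ∨ ∃ r, y = x * r := by
    intro x y
    obtain ⟨u, v, huv, ⟨r, hr⟩, s, hs⟩ := hdist.exists_add_eq_one x y
    by_cases huB : u ∈ B
    · obtain ⟨v, rfl⟩ := hunit v fun hvB => hone (huv ▸ B.add_mem huB hvB)
      exact Or.inr ⟨s * ↑v⁻¹, by rw [← mul_assoc, ← hs, mul_assoc, v.mul_inv, mul_one]⟩
    · obtain ⟨u, rfl⟩ := hunit u huB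
      exact Or.inl ⟨r * ↑u⁻¹, by rw [← mul_assoc, ← hr, mul_assoc, u.mul_inv, mul_one]⟩
  obtain ⟨b, hbB, hb⟩ : ∃ b ∈ B, ∀ x ∈ B, ∃ r, x = b * r := by
    have hT : ∀ T : Finset A, T ⊆ S → ∃ b ∈ B, ∀ x ∈ T, ∃ r, x = b * r := by
      classical
      intro T
      induction T using Finset.induction_on with
      | empty => exact fun _ => ⟨0, B.zero_mem, by simp⟩
      | insert y T _ ih =>
        intro hsub
        obtain ⟨b, hbB, hb⟩ := ih ((Finset.subset_insert _ _).trans hsub)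
        rcases hcomp y b with ⟨r, hr⟩ | ⟨r, hr⟩
        · exact ⟨b, hbB, fun x hx => (Finset.mem_insert.1 hx).elim
            (fun h => ⟨r, h ▸ hr⟩) (hb x)⟩
        · refine ⟨y, (hspan y).1 (Submodule.subset_span (hsub (Finset.mem_insert_self _ _))),
            fun x hx => ?_⟩
          rcases Finset.mem_insert.1 hx with rfl | hx
          · exact ⟨1, by simp⟩
          · obtain ⟨s, rfl⟩ := hb x hx
            exact ⟨r * s, by rw [← mul_assoc, ← hr]⟩
    obtain ⟨b, hbB, hb⟩ := hT S subset_rfl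
    refine ⟨b, hbB, fun x hx => ?_⟩
    have hle : Submodule.span Aᵐᵒᵖ (S : Set A) ≤ Submodule.span Aᵐᵒᵖ {b} :=
      Submodule.span_le.2 fun x hx => by
        obtain ⟨r, rfl⟩ := hb x hx
        exact Submodule.mem_span_singleton.2 ⟨MulOpposite.op r, rfl⟩
    obtain ⟨r, hr⟩ := Submodule.mem_span_singleton.1 (hle ((hspan x).2 hx))
    exact ⟨r.unop, hr.symm⟩
  have hdich : ∀ x, IsUnit x ∨ ∃ y, x = b * y := fun x =>
    (em (x ∈ B)).symm.imp (hunit x) (hb x)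
  have hb0 : b ≠ 0 := by
    rintro rfl
    obtain ⟨r, hr⟩ := hb b₀ hb₀B
    exact hb₀ (by simpa using hr)
  obtain ⟨k, hk, hk'⟩ : ∃ k, b ^ (k + 1) ≠ 0 ∧ b ^ (k + 2) = 0 := by
    by_contra! h
    have hall : ∀ k, b ^ (k + 1) ≠ 0 := by
      intro k
      induction k with
      | zero => simpa using hb0
      | succ k ih => exact h k ih
    obtain ⟨j, hj⟩ := hBnil b hbB
    exact hall j (by rw [pow_succ, hj, zero_mul])
  have hcen : ∀ a, a * b ^ (k + 1) = b ^ (k + 1) * a := by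
    obtain ⟨c, d, hc, hd, -, hd0, hcd⟩ := hCE _ hk
    rw [Semigroup.mem_center_iff] at hc hd
    rcases hdich c with ⟨u, rfl⟩ | ⟨y, rfl⟩
    · intro a
      refine u.isUnit.mul_right_cancel ?_
      rw [mul_assoc, hcd, hd, mul_assoc, hc, ← mul_assoc, hcd]
    · refine absurd ?_ hd0
      rw [← hcd, ← mul_assoc, ← pow_succ, hk', zero_mul]
  have hdich' : ∀ x, IsUnit x ∨ ∃ y, x = y * b := fun x => by
    refine (hdich x).imp id ?_
    rintro ⟨y, rfl⟩
    exact exists_mul_eq_mul_of_pow_central hk' hk hcen hdich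
      (fun a => hb _ (B.mul_mem_left a b hbB)) y
  have hL := left_le_total_and_isArtinian hk' hdich'
  have hR := right_le_total_and_isArtinian hk' hdich
  refine ⟨⟨hR.1, hL.1⟩, ⟨hL.2, hR.2⟩, Set.ext fun x => ?_⟩
  rw [SetLike.mem_coe, SetLike.mem_coe, Ideal.mem_jacobson_iff]
  constructor
  · intro hx
    by_contra hxB
    obtain ⟨u, rfl⟩ := hunit x hxB
    obtain ⟨z, hz⟩ := hx (-↑u⁻¹)
    simp at hz
  · intro hx y
    obtain ⟨u, hu⟩ := (hBnil _ (B.mul_mem_left y x hx)).isUnit_one_add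
    refine ⟨↑u⁻¹, ?_⟩
    have : (↑u⁻¹ : A) * y * x + ↑u⁻¹ - 1 = ↑u⁻¹ * (1 + y * x) - 1 := by
      rw [mul_add, mul_one, mul_assoc, add_comm]
    rw [this, ← hu, u.inv_mul, sub_self]
    exact zero_mem _
end

section
/- A ring A is a right distributive, right Noetherian, centrally essential ring if and only if A is isomorphic to a finite direct product A₁ × ⋯ × Aₙ of rings, where each Aᵢ is either a uniserial Artinian centrally essential ring or a commutative Dedekind domain. -/
/-- The commutative ring structure obtained from a ring whose multiplication is
commutative. -/
def Ring.commRingOfComm (A : Type*) [inst : Ring A] (h : ∀ x y : A, x * y = y * x) :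
    CommRing A := { inst with mul_comm := h }

/-- A (possibly noncommutative) ring is a *commutative Dedekind domain* if its
multiplication is commutative and, regarded as a commutative ring, it is a Dedekind
domain. -/
def IsCommDedekindDomain (A : Type*) [Ring A] : Prop :=
  ∃ h : ∀ x y : A, x * y = y * x, @IsDedekindDomain A (Ring.commRingOfComm A h)

/-- A ring which is either a uniserial Artinian centrally essential ring or a
commutative Dedekind domain. -/
def IsGoodFactor (R : Type*) [Ring R] : Prop :=
  (IsUniserialRing R ∧ IsArtinianBothSides R ∧ IsCentrallyEssential R) ∨
    IsCommDedekindDomain R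

universe u

namespace IsCentrallyEssential

variable {A : Type*} [Ring A]

theorem exists_mul_eq (hE : IsCentrallyEssential A) {a : A} (ha : a ≠ 0) :
    ∃ c d : A, (∀ x, x * c = c * x) ∧ (∀ x, x * d = d * x) ∧ c ≠ 0 ∧ d ≠ 0 ∧ a * c = d := by
  obtain ⟨c, d, hc, hd, h⟩ := hE a ha
  exact ⟨c, d, Semigroup.mem_center_iff.1 hc, Semigroup.mem_center_iff.1 hd, h⟩

theorem mul_mul_one_sub_eq_zero (hE : IsCentrallyEssential A) {e : A} (he : e * e = e) (x : A) :
    e * x * (1 - e) = 0 := by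
  by_contra h
  obtain ⟨c, d, hc, hd, -, hd0, h⟩ := hE.exists_mul_eq h
  apply hd0
  have h1 : d * (1 - e) = d := by
    have h3 : (1 - e) * (1 - e) = 1 - e := IsIdempotentElem.one_sub he
    rw [← h, mul_assoc, ← hc, ← mul_assoc, mul_assoc (e * x), h3]
  have h2 : e * d = d := by
    rw [← h, ← mul_assoc, ← mul_assoc, ← mul_assoc, he]
  rw [← h2, hd, ← h1, mul_assoc, sub_mul, one_mul, he, sub_self, mul_zero]

/-- In a centrally essential ring every idempotent is central. -/
theorem isMulCentral_of_isIdempotentElem (hE : IsCentrallyEssential A) {e : A}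
    (he : IsIdempotentElem e) : IsMulCentral e := by
  refine Semigroup.mem_center_iff.2 fun x => ?_
  have h1 := hE.mul_mul_one_sub_eq_zero he x
  have h2 := hE.mul_mul_one_sub_eq_zero he.one_sub x
  rw [mul_sub, mul_one, sub_eq_zero] at h1
  rw [sub_sub_cancel, sub_mul, one_mul, sub_mul, sub_eq_zero] at h2
  rw [h1, h2]

/-- A centrally essential ring without zero divisors is commutative. -/
theorem mul_comm_of_eq_zero_or_eq_zero (hE : IsCentrallyEssential A)
    (hD : ∀ x y : A, x * y = 0 → x = 0 ∨ y = 0) (a b : A) : a * b = b * a := by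
  by_cases ha : a = 0
  · simp [ha]
  obtain ⟨c, d, hc, hd, hc0, -, h⟩ := hE.exists_mul_eq ha
  refine sub_eq_zero.1 ((hD _ c ?_).resolve_right hc0)
  rw [sub_mul, mul_assoc, hc, ← mul_assoc, h, mul_assoc, h, hd, sub_self]

end IsCentrallyEssential

section RightIdeals

variable {A : Type*} [Ring A]

theorem mem_span_op_singleton {x y : A} :
    x ∈ Submodule.span Aᵐᵒᵖ {y} ↔ ∃ a, y * a = x := by
  rw [Submodule.mem_span_singleton]
  exact ⟨fun ⟨a, h⟩ => ⟨a.unop, h⟩, fun ⟨a, h⟩ => ⟨MulOpposite.op a, h⟩⟩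

/-- The right annihilator of an element, as a right ideal. -/
def rightAnnihilator (y : A) : Submodule Aᵐᵒᵖ A where
  carrier := {x | y * x = 0}
  add_mem' := fun {a b} ha hb => by
    change y * a = 0 at ha
    change y * b = 0 at hb
    change y * (a + b) = 0
    rw [mul_add, ha, hb, add_zero]
  zero_mem' := mul_zero y
  smul_mem' := fun c x hx => by
    change y * (x * c.unop) = 0
    change y * x = 0 at hx
    rw [← mul_assoc, hx, zero_mul]

theorem mem_rightAnnihilator {x y : A} : x ∈ rightAnnihilator y ↔ y * x = 0 := Iff.rfl

/-- The elementwise characterization of right distributivity. -/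
theorem isRightDistributive_iff :
    IsRightDistributive A ↔
      ∀ m n : A, ∃ a u v, m * a = n * u ∧ n * (1 - a) = m * v := by
  constructor
  · intro h m n
    have h1 := h (Submodule.span Aᵐᵒᵖ {m + n}) (Submodule.span Aᵐᵒᵖ {m}) (Submodule.span Aᵐᵒᵖ {n})
    have h2 : m + n ∈ Submodule.span Aᵐᵒᵖ {m + n} ⊓
        (Submodule.span Aᵐᵒᵖ {m} ⊔ Submodule.span Aᵐᵒᵖ {n}) :=
      ⟨Submodule.mem_span_singleton_self _, Submodule.add_mem_sup
        (Submodule.mem_span_singleton_self _) (Submodule.mem_span_singleton_self _)⟩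
    rw [h1] at h2
    obtain ⟨p, ⟨hp1, hp2⟩, q, ⟨-, hq2⟩, hpq⟩ := Submodule.mem_sup.1 h2
    obtain ⟨b, rfl⟩ := mem_span_op_singleton.1 hp1
    obtain ⟨c, hc⟩ := mem_span_op_singleton.1 hp2
    obtain ⟨d, rfl⟩ := mem_span_op_singleton.1 hq2
    refine ⟨1 - b, d - (1 - b), c - b, ?_, ?_⟩
    · rw [← sub_eq_zero, ← sub_eq_zero.2 hpq.symm]
      noncomm_ring
    · rw [mul_sub m, hc]
      noncomm_ring
  · intro h I J K
    refine le_antisymm ?_ (le_inf (sup_le inf_le_left inf_le_left)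
      (sup_le (inf_le_right.trans le_sup_left) (inf_le_right.trans le_sup_right)))
    rintro x ⟨hxI, hx⟩
    obtain ⟨j, hj, k, hk, rfl⟩ := Submodule.mem_sup.1 hx
    obtain ⟨a, u, v, h1, h2⟩ := h j k
    have e1 : (j + k) * a = k * (u + a) := by rw [add_mul, h1, mul_add]
    have e2 : (j + k) * (1 - a) = j * (1 - a + v) := by rw [add_mul, h2, mul_add]
    refine Submodule.mem_sup.2 ⟨(j + k) * (1 - a),
      ⟨I.smul_mem (MulOpposite.op (1 - a)) hxI, e2 ▸ J.smul_mem (MulOpposite.op _) hj⟩,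
      (j + k) * a, ⟨I.smul_mem (MulOpposite.op a) hxI, e1 ▸ K.smul_mem (MulOpposite.op _) hk⟩, ?_⟩
    noncomm_ring

theorem exists_pow_mul_eq_zero_imp [IsNoetherian Aᵐᵒᵖ A] (y : A) :
    ∃ k, ∀ n x, y ^ n * x = 0 → y ^ k * x = 0 := by
  have hmono : Monotone fun n => rightAnnihilator (y ^ n) := by
    intro m n hmn x hx
    rw [mem_rightAnnihilator] at *
    obtain ⟨i, rfl⟩ := Nat.exists_eq_add_of_le' hmn
    rw [pow_add, mul_assoc, hx, mul_zero]
  obtain ⟨k, hk⟩ := monotone_stabilizes_iff_noetherian.2 ‹IsNoetherian Aᵐᵒᵖ A› ⟨_, hmono⟩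
  refine ⟨k, fun n x hx => ?_⟩
  rcases le_total k n with h | h
  · have := hk n h
    change rightAnnihilator (y ^ k) = rightAnnihilator (y ^ n) at this
    rwa [← mem_rightAnnihilator, this]
  · exact hmono h hx

/-- In a right Noetherian ring, any nonempty set has an element `x` whose associated right ideal
is maximal. -/
theorem exists_maximal_right_ideal [IsNoetherian Aᵐᵒᵖ A] (f : A → Submodule Aᵐᵒᵖ A) (p : A → Prop)
    (hp : ∃ x, p x) : ∃ x, p x ∧ ∀ y, p y → f x ≤ f y → f y ≤ f x := by
  obtain ⟨x, hx⟩ := hp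
  obtain ⟨I, ⟨y, hy, rfl⟩, hI⟩ :=
    set_has_maximal_iff_noetherian.2 ‹IsNoetherian Aᵐᵒᵖ A› (f '' {x | p x}) ⟨_, x, hx, rfl⟩
  refine ⟨y, hy, fun w hw h => ?_⟩
  by_contra hlt
  exact hI _ ⟨w, hw, rfl⟩ (lt_of_le_not_ge h hlt)

end RightIdeals

section CentralPrime

variable {A : Type*} [Ring A]

/-- A nonzero central element whose annihilator is a completely prime ideal. -/
structure IsCentralPrimeWitness (z : A) : Prop where
  comm : ∀ x, x * z = z * x
  ne_zero : z ≠ 0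
  mul_eq_zero : ∀ x y, x * y * z = 0 → x * z = 0 ∨ y * z = 0

theorem IsCentrallyEssential.exists_isCentralPrimeWitness [Nontrivial A]
    [IsNoetherian Aᵐᵒᵖ A] (hE : IsCentrallyEssential A) :
    ∃ z : A, IsCentralPrimeWitness z := by
  obtain ⟨z, ⟨hz, hz0⟩, hmax⟩ := exists_maximal_right_ideal (rightAnnihilator (A := A))
    (fun z => (∀ x, x * z = z * x) ∧ z ≠ 0) ⟨1, by simp, one_ne_zero⟩
  refine ⟨z, hz, hz0, fun x y hxy => or_iff_not_imp_left.2 fun hx => ?_⟩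
  obtain ⟨c, d, hc, hd, -, hd0, h⟩ := hE.exists_mul_eq hx
  have hle : rightAnnihilator z ≤ rightAnnihilator d := fun w hw => by
    rw [mem_rightAnnihilator] at *
    rw [← h, mul_assoc, ← hc, mul_assoc, ← mul_assoc z, hw, zero_mul, mul_zero]
  have hy : y ∈ rightAnnihilator d := by
    rw [mem_rightAnnihilator, ← h, mul_assoc, ← hc, mul_assoc, ← mul_assoc z, ← hz, ← mul_assoc,
      ← mul_assoc, hxy, zero_mul]
  have := hmax d ⟨hd, hd0⟩ hle hy
  rwa [mem_rightAnnihilator, ← hz] at this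

namespace IsCentralPrimeWitness

variable {z : A}

theorem mul_left_eq_zero (_hz : IsCentralPrimeWitness z) {x : A} (hx : x * z = 0) (a : A) :
    a * x * z = 0 := by
  rw [mul_assoc, hx, mul_zero]

variable (hz : IsCentralPrimeWitness z)
include hz

theorem mul_right_eq_zero {x : A} (hx : x * z = 0) (a : A) : x * a * z = 0 := by
  rw [mul_assoc, hz.comm, ← mul_assoc, hx, zero_mul]

theorem mul_ne_zero {x y : A} (hx : x * z ≠ 0) (hy : y * z ≠ 0) : x * y * z ≠ 0 := fun h =>
  (hz.mul_eq_zero x y h).elim hx hy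

theorem pow_mul_ne_zero {x : A} (hx : x * z ≠ 0) (n : ℕ) : x ^ n * z ≠ 0 := by
  induction n with
  | zero => simpa using hz.ne_zero
  | succ n ih => rw [pow_succ]; exact hz.mul_ne_zero ih hx

theorem one_sub_mul_ne_zero {x : A} (hx : x * z = 0) : (1 - x) * z ≠ 0 := by
  rw [sub_mul, hx, one_mul, sub_zero]
  exact hz.ne_zero

variable (hC : ∀ m n : A, ∃ a u v, m * a = n * u ∧ n * (1 - a) = m * v)
include hC

/-- The right Ore condition for the complement of the annihilator. -/
theorem exists_mul_eq_mul {s : A} (hs : s * z ≠ 0) (y : A) :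
    ∃ s' b, s' * z ≠ 0 ∧ y * s' = s * b := by
  obtain ⟨a, u, v, h1, h2⟩ := hC y s
  by_cases ha : a * z = 0
  · have h3 : y * v * z ≠ 0 := h2 ▸ hz.mul_ne_zero hs (hz.one_sub_mul_ne_zero ha)
    refine ⟨v, 1 - a, fun hv => h3 (hz.mul_left_eq_zero hv y), h2.symm⟩
  · exact ⟨a, u, ha, h1⟩

omit hC in
theorem eq_zero_of_one_sub_mul_eq_zero
    (hI : ∀ e : A, IsIdempotentElem e → e = 0 ∨ e = 1) {q : A} (hq : q * z = 0)
    (hnil : IsNilpotent (q * (1 - q))) {d : A} (hd : (1 - q) * d = 0) : d = 0 := by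
  obtain ⟨n, hn⟩ := hnil
  rcases Nat.eq_zero_or_pos n with rfl | hn0
  · rw [pow_zero] at hn
    rw [← one_mul d, hn, zero_mul]
  obtain ⟨m, rfl⟩ := Nat.exists_eq_add_of_le' hn0
  have hidem := isIdempotentElem_one_sub_one_sub_pow_pow q (m + 1)
    (by rw [pow_two, ← mul_one_sub, hn])
  have h1 : (1 - q ^ (m + 1)) * z = z := by
    rw [pow_succ, sub_mul, hz.mul_left_eq_zero hq, one_mul, sub_zero]
  have h2 : ∀ n, (1 - q ^ (m + 1)) ^ n * z = z := by
    intro n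
    induction n with
    | zero => simp
    | succ n ih => rw [pow_succ, mul_assoc, h1, ih]
  have h3 : (1 - q ^ (m + 1)) * d = 0 := by
    rw [← geom_sum_mul_neg, mul_assoc, hd, mul_zero]
  rcases hI _ hidem with h | h
  · rw [sub_eq_zero] at h
    rw [← one_mul d, h, pow_succ, mul_assoc, h3, mul_zero]
  · exfalso
    apply hz.ne_zero
    rw [← h2 (m + 1), sub_eq_self.1 h, zero_mul]

omit hC in
theorem exists_one_sub_mul_eq_zero [IsNoetherian Aᵐᵒᵖ A] :
    ∃ q : A, q * z = 0 ∧ ∀ d, (∀ x, x * d = d * x) →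
      (∃ q', q' * z = 0 ∧ d * (1 - q') = 0) → (1 - q) * d = 0 := by
  obtain ⟨q, hq, hmax⟩ := exists_maximal_right_ideal (fun q : A => rightAnnihilator (1 - q))
    (fun q => q * z = 0) ⟨0, zero_mul z⟩
  refine ⟨q, hq, fun d hd ⟨q', hq', h⟩ => ?_⟩
  have e : 1 - (q + q' - q' * q) = (1 - q') * (1 - q) := by noncomm_ring
  have hle := hmax (q + q' - q' * q)
    (by rw [sub_mul, add_mul, hq, hq', hz.mul_left_eq_zero hq]; simp)
    (fun x hx => by
      rw [mem_rightAnnihilator] at *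
      rw [e, mul_assoc, hx, mul_zero])
  refine hle (x := d) ?_
  rw [mem_rightAnnihilator, e, mul_assoc, hd, ← mul_assoc, hd, h, zero_mul]

theorem eq_zero_of_mul_eq_zero [IsNoetherian Aᵐᵒᵖ A] (hE : IsCentrallyEssential A)
    (hI : ∀ e : A, IsIdempotentElem e → e = 0 ∨ e = 1) (hzz : z * z ≠ 0) {x : A}
    (hx : x * z = 0) : x = 0 := by
  have hK : ∀ d, d * z = 0 → ∃ q', q' * z = 0 ∧ d * (1 - q') = 0 := by
    intro d hd
    obtain ⟨a, u, v, h1, h2⟩ := hC d z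
    refine ⟨1 - a, ?_, ?_⟩
    · have : z * (1 - a) * z = 0 := by rw [h2]; exact hz.mul_right_eq_zero hd v
      exact (hz.mul_eq_zero _ _ this).resolve_left hzz
    · have : z * u * z = 0 := by rw [← h1]; exact hz.mul_right_eq_zero hd a
      rw [sub_sub_cancel, h1, ← hz.comm]
      exact (hz.mul_eq_zero _ _ this).resolve_left hzz
  obtain ⟨q, hq, hqd⟩ := hz.exists_one_sub_mul_eq_zero
  have hyz : q * (1 - q) * z = 0 := hz.mul_right_eq_zero hq _
  have hnil : IsNilpotent (q * (1 - q)) := by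
    obtain ⟨k, hk⟩ := exists_pow_mul_eq_zero_imp (q * (1 - q))
    refine ⟨k + 1, ?_⟩
    by_contra hne
    obtain ⟨c, d, hc, hd, -, hd0, h⟩ := hE.exists_mul_eq hne
    have hdz : d * z = 0 := by
      rw [← h, pow_succ']
      exact hz.mul_right_eq_zero (hz.mul_right_eq_zero hyz _) _
    have h0 : q * (1 - q) * d = 0 := by rw [mul_assoc, hqd d hd (hK d hdz), mul_zero]
    rw [← h, ← mul_assoc, ← pow_succ'] at h0
    apply hd0
    rw [← h, pow_succ', mul_assoc, hk _ _ h0, mul_zero]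
  by_contra hne
  obtain ⟨c, d, hc, hd, -, hd0, h⟩ := hE.exists_mul_eq hne
  refine hd0 (hz.eq_zero_of_one_sub_mul_eq_zero hI hq hnil (hqd d hd (hK d ?_)))
  rw [← h]
  exact hz.mul_right_eq_zero hx c

theorem exists_eq_pow_mul (hzz : z * z = 0) {s : A} (hs : s * z ≠ 0) (n : ℕ) {w : A}
    (hw : ∀ p, p * z = 0 → w * p = 0) : ∃ u, w = s ^ n * u := by
  obtain ⟨a, u, v, h1, h2⟩ := hC w (s ^ n)
  have h3 : s ^ n * (1 - a) * z = 0 := h2 ▸ hz.mul_right_eq_zero (hw z hzz) v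
  have h4 := hw _ ((hz.mul_eq_zero _ _ h3).resolve_left (hz.pow_mul_ne_zero hs n))
  rw [mul_sub, mul_one, sub_eq_zero] at h4
  exact ⟨u, h4.trans h1⟩

theorem exists_one_sub_mul_mul_eq_zero [IsNoetherian Aᵐᵒᵖ A] (hE : IsCentrallyEssential A)
    (hzz : z * z = 0) {s : A} (hs : s * z ≠ 0) : ∃ t, (1 - s * t) * z = 0 := by
  obtain ⟨k, hk⟩ := exists_pow_mul_eq_zero_imp s
  have key : ∀ w, (∀ p, p * z = 0 → w * p = 0) →
      ∃ w', (∀ p, p * z = 0 → w' * p = 0) ∧ w = s * w' ∧ w = w' * s := by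
    intro w hw
    obtain ⟨u, hu⟩ := hz.exists_eq_pow_mul hC hzz hs (k + 1) hw
    have hw' : ∀ p, p * z = 0 → s ^ k * u * p = 0 := fun p hp => by
      rw [mul_assoc]
      apply hk (k + 1)
      rw [← mul_assoc, ← hu, hw p hp]
    have hsu : w = s * (s ^ k * u) := by rw [hu, pow_succ', mul_assoc]
    refine ⟨s ^ k * u, hw', hsu, ?_⟩
    generalize s ^ k * u = w' at hw' hsu
    by_cases hw0 : w' = 0
    · rw [hsu, hw0, mul_zero, zero_mul]
    obtain ⟨c, d, hc, hd, -, hd0, h⟩ := hE.exists_mul_eq hw0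
    have hcz : c * z ≠ 0 := fun hcz => hd0 (by rw [← h, hw' c hcz])
    have hv : ∀ p, p * z = 0 → (s * w' - w' * s) * p = 0 := fun p hp => by
      rw [sub_mul, mul_assoc, hw' p hp, mul_assoc, hw' _ (hz.mul_left_eq_zero hp s)]
      simp
    have hcv : c * (s * w' - w' * s) = 0 := by
      rw [← hc, sub_mul, mul_assoc, h, mul_assoc, hc, ← mul_assoc, h, hd, sub_self]
    obtain ⟨l, hl⟩ := exists_pow_mul_eq_zero_imp c
    obtain ⟨u', hu'⟩ := hz.exists_eq_pow_mul hC hzz hcz l hv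
    rw [hu', ← mul_assoc, ← pow_succ'] at hcv
    rw [hl _ _ hcv, sub_eq_zero] at hu'
    rw [hsu, hu']
  obtain ⟨w, ⟨hw, hwz⟩, hmax⟩ := exists_maximal_right_ideal
    (fun w : A => Submodule.span Aᵐᵒᵖ {w})
    (fun w => (∀ p, p * z = 0 → w * p = 0) ∧ ∀ x, w * x = 0 → x * z = 0)
    ⟨z, fun p hp => by rw [← hz.comm, hp], fun x hx => by rw [hz.comm, hx]⟩
  obtain ⟨w', hw', h1, h2⟩ := key w hw
  have hwz' : ∀ x, w' * x = 0 → x * z = 0 := fun x hx => hwz x (by rw [h1, mul_assoc, hx, mul_zero])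
  have hle := hmax w' ⟨hw', hwz'⟩ ((Submodule.span_singleton_le_iff_mem _ _).2
    (mem_span_op_singleton.2 ⟨s, h2.symm⟩))
  obtain ⟨a, ha⟩ := mem_span_op_singleton.1 ((Submodule.span_singleton_le_iff_mem _ _).1 hle)
  refine ⟨a, hwz' _ ?_⟩
  rw [mul_sub, mul_one, ← mul_assoc, ← h2, ha, sub_self]

theorem isNilpotent_of_mul_eq_zero [IsNoetherian Aᵐᵒᵖ A] (hE : IsCentrallyEssential A)
    (hdiv : ∀ s, s * z ≠ 0 → ∃ t, (1 - s * t) * z = 0) {y : A} (hy : y * z = 0)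
    (hyd : ∀ d, (∀ x, x * d = d * x) → (∃ q', q' * z = 0 ∧ d * (1 - q') = 0) → y * d = 0) :
    IsNilpotent y := by
  by_contra hnil
  have hne : ∀ n, y ^ n ≠ 0 := fun n hn => hnil ⟨n, hn⟩
  obtain ⟨k, hk⟩ := exists_pow_mul_eq_zero_imp y
  have hK : ∃ s, s * z ≠ 0 ∧ y ^ (k + 1) * s = 0 := by
    obtain ⟨b, u, v, h1, h2⟩ := hC z (y ^ k)
    by_cases hb : b * z = 0
    · obtain ⟨b', v', hb', h3⟩ := hz.exists_mul_eq_mul hC (hz.one_sub_mul_ne_zero hb) y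
      refine ⟨b', hb', ?_⟩
      have h4 : (1 - b) * v' * z = 0 := by rw [← h3]; exact hz.mul_right_eq_zero hy b'
      have hv' := (hz.mul_eq_zero _ _ h4).resolve_left (hz.one_sub_mul_ne_zero hb)
      rw [pow_succ, mul_assoc, h3, ← mul_assoc, h2, mul_assoc, ← hz.comm, mul_assoc, hv', mul_zero]
    · exfalso
      obtain ⟨t, ht⟩ := hdiv b hb
      have hzt : z = y ^ k * (u * t) := by
        rw [← mul_assoc, ← h1, mul_assoc, ← hz.comm]
        rwa [sub_mul, one_mul, sub_eq_zero] at ht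
      have h0 : y ^ (k + 1) * (u * t) = 0 := by rw [pow_succ', mul_assoc, ← hzt, hy]
      exact hz.ne_zero (hzt.trans (hk _ _ h0))
  obtain ⟨s, hs, hys⟩ := hK
  obtain ⟨c, d, hc, hd, -, hd0, h⟩ := hE.exists_mul_eq (hne (k + 1))
  have hds : d * s = 0 := by rw [← h, mul_assoc, ← hc, ← mul_assoc, hys, zero_mul]
  obtain ⟨t, ht⟩ := hdiv s hs
  have h0 := hyd d hd ⟨1 - s * t, ht, by rw [sub_sub_cancel, ← mul_assoc, hds, zero_mul]⟩
  rw [← h, ← mul_assoc, ← pow_succ'] at h0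
  apply hd0
  rw [← h, pow_succ', mul_assoc, hk _ _ h0, mul_zero]

theorem isNilpotent_and_isUnit [IsNoetherian Aᵐᵒᵖ A] (hE : IsCentrallyEssential A)
    (hI : ∀ e : A, IsIdempotentElem e → e = 0 ∨ e = 1) (hzz : z * z = 0) :
    (∀ y, y * z = 0 → IsNilpotent y) ∧ ∀ s, s * z ≠ 0 → IsUnit s := by
  have hdiv : ∀ s, s * z ≠ 0 → ∃ t, (1 - s * t) * z = 0 := fun s hs =>
    hz.exists_one_sub_mul_mul_eq_zero hC hE hzz hs
  have hnil : ∀ y, y * z = 0 → IsNilpotent y := by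
    obtain ⟨q, hq, hqd⟩ := hz.exists_one_sub_mul_eq_zero
    have hqn := hz.isNilpotent_of_mul_eq_zero hC hE hdiv
      (hz.mul_right_eq_zero hq (1 - q)) fun d hd hd' => by rw [mul_assoc, hqd d hd hd', mul_zero]
    refine fun y hy => hz.isNilpotent_of_mul_eq_zero hC hE hdiv hy fun d hd hd' => ?_
    rw [hz.eq_zero_of_one_sub_mul_eq_zero hI hq hqn (hqd d hd hd'), mul_zero]
  refine ⟨hnil, ?_⟩
  have hright : ∀ s, s * z ≠ 0 → ∃ r, s * r = 1 := by
    intro s hs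
    obtain ⟨t, ht⟩ := hdiv s hs
    obtain ⟨u, hu⟩ := (hnil _ ht).isUnit_one_sub
    rw [sub_sub_cancel] at hu
    exact ⟨t * ↑u⁻¹, by rw [← mul_assoc, ← hu, Units.mul_inv]⟩
  intro s hs
  obtain ⟨r, hr⟩ := hright s hs
  have hrz : r * z ≠ 0 := fun h => hz.ne_zero (by rw [← one_mul z, ← hr, mul_assoc, h, mul_zero])
  obtain ⟨t, ht⟩ := hright r hrz
  have hst : s = t := by rw [← mul_one s, ← ht, ← mul_assoc, hr, one_mul]
  exact ⟨⟨s, r, hr, hst ▸ ht⟩, rfl⟩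

end IsCentralPrimeWitness

end CentralPrime

section Uniserial

theorem IsCentralPrimeWitness.exists_isNilpotent_generator {A : Type*} [Ring A]
    [IsNoetherian Aᵐᵒᵖ A] {z : A} (hz : IsCentralPrimeWitness z)
    (hC : ∀ m n : A, ∃ a u v, m * a = n * u ∧ n * (1 - a) = m * v) (hE : IsCentrallyEssential A)
    (hnil : ∀ y, y * z = 0 → IsNilpotent y) (hunit : ∀ s, s * z ≠ 0 → IsUnit s) :
    ∃ x : A, IsNilpotent x ∧ (∀ a, IsUnit a ∨ ∃ b, a = x * b) ∧ ∀ a, IsUnit a ∨ ∃ b, a = b * x := by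
  obtain ⟨x, hx, hmax⟩ := exists_maximal_right_ideal
    (fun x : A => Submodule.span Aᵐᵒᵖ {x}) (fun x => x * z = 0) ⟨0, zero_mul z⟩
  have hgen : ∀ a, a * z = 0 → ∃ b, a = x * b := by
    intro a ha
    obtain ⟨c, u, v, h1, h2⟩ := hC a x
    by_cases hc : c * z = 0
    · obtain ⟨t, ht⟩ := hunit _ (hz.one_sub_mul_ne_zero hc)
      have hxa : x ∈ Submodule.span Aᵐᵒᵖ {a} := mem_span_op_singleton.2
        ⟨v * ↑t⁻¹, by rw [← mul_assoc, ← h2, ← ht, mul_assoc, Units.mul_inv, mul_one]⟩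
      have hle := hmax a ha ((Submodule.span_singleton_le_iff_mem _ _).2 hxa)
      obtain ⟨b, hb⟩ := mem_span_op_singleton.1 ((Submodule.span_singleton_le_iff_mem _ _).1 hle)
      exact ⟨b, hb.symm⟩
    · obtain ⟨t, rfl⟩ := hunit c hc
      exact ⟨u * ↑t⁻¹, by rw [← mul_assoc, ← h1, mul_assoc, Units.mul_inv, mul_one]⟩
  have hcomm : ∀ b, ∃ w, x * b = b * x + x * (x * w) := by
    intro b
    by_cases hx0 : x = 0
    · exact ⟨0, by simp [hx0]⟩
    obtain ⟨b', hb'⟩ := hgen (b * x) (hz.mul_left_eq_zero hx b)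
    have hbb : (b - b') * z = 0 := by
      by_contra h
      obtain ⟨t, ht⟩ := hunit _ h
      obtain ⟨c, d, hc, hd, -, hd0, hxc⟩ := hE.exists_mul_eq hx0
      apply hd0
      have h0 : d * (b - b') = 0 := by
        rw [← hxc, mul_assoc, ← hc, ← mul_assoc, mul_sub, ← hb', sub_mul, mul_assoc, hc,
          ← mul_assoc, mul_assoc b, hxc, hd, sub_self]
      rw [← ht] at h0
      exact (Units.mul_left_eq_zero t).1 h0
    obtain ⟨w, hw⟩ := hgen _ hbb
    exact ⟨w, by rw [← hw, hb', mul_sub, add_sub_cancel]⟩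
  have hleft : ∀ j b, ∃ l w, x * b = l * x + x ^ (j + 1) * w := by
    intro j b
    induction j with
    | zero => exact ⟨0, b, by simp⟩
    | succ j ih =>
      obtain ⟨l, w, h⟩ := ih
      obtain ⟨w', hw'⟩ := hcomm w
      exact ⟨l + x ^ j * w, w', by rw [h, pow_succ, mul_assoc, hw']; noncomm_ring⟩
  refine ⟨x, hnil x hx, fun a => ?_, fun a => ?_⟩
  · exact or_iff_not_imp_left.2 fun ha => hgen a (not_not.1 (mt (hunit a) ha))
  · refine or_iff_not_imp_left.2 fun ha => ?_
    obtain ⟨b, rfl⟩ := hgen a (not_not.1 (mt (hunit a) ha))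
    obtain ⟨n, hn⟩ := hnil x hx
    obtain ⟨l, w, h⟩ := hleft n b
    exact ⟨l, by rw [h, pow_succ, hn, zero_mul, zero_mul, add_zero]⟩

section NilpotentGenerator

variable {R : Type*} [Ring R] {x : R}

theorem exists_eq_unit_mul_pow (hgen : ∀ a : R, IsUnit a ∨ ∃ b, a = b * x) (k : ℕ) (a : R) :
    (∃ (u : Rˣ) (m : ℕ), m < k ∧ a = u * x ^ m) ∨ ∃ b, a = b * x ^ k := by
  induction k with
  | zero => exact Or.inr ⟨a, by simp⟩
  | succ k ih =>
    rcases ih with ⟨u, m, hm, h⟩ | ⟨b, rfl⟩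
    · exact Or.inl ⟨u, m, hm.trans k.lt_succ_self, h⟩
    · rcases hgen b with ⟨u, rfl⟩ | ⟨b, rfl⟩
      · exact Or.inl ⟨u, k, k.lt_succ_self, rfl⟩
      · exact Or.inr ⟨b, by rw [pow_succ', mul_assoc]⟩

theorem exists_pow_mem_iff (hgen : ∀ a : R, IsUnit a ∨ ∃ b, a = b * x) {n : ℕ} (hn : x ^ n = 0)
    (a : R) : ∃ m, m < n + 1 ∧ ∀ I : Ideal R, a ∈ I ↔ x ^ m ∈ I := by
  rcases exists_eq_unit_mul_pow hgen n a with ⟨u, m, hm, rfl⟩ | ⟨b, rfl⟩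
  · exact ⟨m, hm.trans n.lt_succ_self, fun I => Ideal.unit_mul_mem_iff_mem I u.isUnit⟩
  · exact ⟨n, n.lt_succ_self, fun I => by simp [hn]⟩

theorem Ideal.total_of_isNilpotent_generator (hx : IsNilpotent x)
    (hgen : ∀ a : R, IsUnit a ∨ ∃ b, a = b * x) (I J : Ideal R) : I ≤ J ∨ J ≤ I := by
  obtain ⟨n, hn⟩ := hx
  by_contra! h
  obtain ⟨a, haI, haJ⟩ := Set.not_subset.1 h.1
  obtain ⟨b, hbJ, hbI⟩ := Set.not_subset.1 h.2
  obtain ⟨m, -, hm⟩ := exists_pow_mem_iff hgen hn a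
  obtain ⟨k, -, hk⟩ := exists_pow_mem_iff hgen hn b
  rcases le_total m k with h | h <;> obtain ⟨i, rfl⟩ := Nat.exists_eq_add_of_le' h
  · exact hbI ((hk I).2 (pow_add x i m ▸ I.mul_mem_left _ ((hm I).1 haI)))
  · exact haJ ((hm J).2 (pow_add x i k ▸ J.mul_mem_left _ ((hk J).1 hbJ)))

theorem isArtinianRing_of_isNilpotent_generator (hx : IsNilpotent x)
    (hgen : ∀ a : R, IsUnit a ∨ ∃ b, a = b * x) : IsArtinianRing R := by
  obtain ⟨n, hn⟩ := hx
  have hinj : Function.Injective fun I : Ideal R => {m : Fin (n + 1) | x ^ (m : ℕ) ∈ I} := by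
    intro I J h
    ext a
    obtain ⟨m, hmn, hm⟩ := exists_pow_mem_iff hgen hn a
    rw [hm, hm]
    exact Set.ext_iff.1 h ⟨m, hmn⟩
  have := Finite.of_injective _ hinj
  exact Finite.to_wellFoundedLT

end NilpotentGenerator

/-- Right ideals of `A`, as a module over `Aᵐᵒᵖ`, are left ideals of `Aᵐᵒᵖ`. -/
def opSelfLinearEquiv (A : Type*) [Ring A] : A ≃ₗ[Aᵐᵒᵖ] Aᵐᵒᵖ where
  __ := MulOpposite.opAddEquiv
  map_smul' _ _ := rfl

theorem isUniserialRing_and_isArtinianBothSides {A : Type*} [Ring A] {x : A} (hx : IsNilpotent x)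
    (hr : ∀ a, IsUnit a ∨ ∃ b, a = x * b) (hl : ∀ a, IsUnit a ∨ ∃ b, a = b * x) :
    IsUniserialRing A ∧ IsArtinianBothSides A := by
  have hx' : IsNilpotent (MulOpposite.op x) := by
    obtain ⟨n, hn⟩ := hx
    exact ⟨n, by rw [← MulOpposite.op_pow, hn, MulOpposite.op_zero]⟩
  have hr' : ∀ a : Aᵐᵒᵖ, IsUnit a ∨ ∃ b, a = b * MulOpposite.op x := fun a =>
    (hr a.unop).imp (fun h => h.op) fun ⟨b, hb⟩ => ⟨MulOpposite.op b, MulOpposite.unop_injective hb⟩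
  have := isArtinianRing_of_isNilpotent_generator hx' hr'
  refine ⟨⟨fun I J => ?_, Ideal.total_of_isNilpotent_generator hx hl⟩,
    isArtinianRing_of_isNilpotent_generator hx hl,
    (opSelfLinearEquiv A).isArtinian_iff.2 this⟩
  let e := Submodule.orderIsoMapComap (opSelfLinearEquiv A)
  rw [← e.le_iff_le, ← e.le_iff_le (x := J)]
  exact Ideal.total_of_isNilpotent_generator hx' hr' _ _

end Uniserial

section Dedekind

theorem IsDedekindDomain.of_noetherian_of_exists_mul_eq {A : Type*} [CommRing A] [IsDomain A]
    [IsNoetherianRing A]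
    (hC : ∀ m n : A, ∃ a u v, m * a = n * u ∧ n * (1 - a) = m * v) : IsDedekindDomain A := by
  have : IsDedekindDomainDvr A :=
    { is_dvr_at_nonzero_prime := fun P hP hPprime => by
        have := hPprime
        have hval : ValuationRing (Localization.AtPrime P) := by
          rw [ValuationRing.iff_dvd_total]
          refine ⟨fun p q => ?_⟩
          obtain ⟨⟨m, s⟩, hm⟩ := IsLocalization.surj P.primeCompl p
          obtain ⟨⟨n, t⟩, hn⟩ := IsLocalization.surj P.primeCompl q
          have hs := IsLocalization.map_units (Localization.AtPrime P) s
          have ht := IsLocalization.map_units (Localization.AtPrime P) t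
          dsimp only at hm hn
          rw [← hs.mul_right_dvd, ← ht.dvd_mul_right, hm, hn, ← ht.mul_right_dvd (a := q),
            ← hs.dvd_mul_right (b := p), hm, hn]
          obtain ⟨a, u, v, h1, h2⟩ := hC m n
          have key : ∀ {b k l w : A}, b ∉ P → k * b = l * w →
              algebraMap A (Localization.AtPrime P) l ∣ algebraMap A _ k := by
            intro b k l w hb h
            have hbu := IsLocalization.map_units (Localization.AtPrime P) (⟨b, hb⟩ : P.primeCompl)
            rw [← hbu.dvd_mul_right, ← map_mul, h, map_mul]
            exact dvd_mul_right _ _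
          by_cases ha : a ∈ P
          · refine Or.inl (key (fun h => hPprime.ne_top ?_) h2)
            rw [Ideal.eq_top_iff_one, ← add_sub_cancel a 1]
            exact P.add_mem ha h
          · exact Or.inr (key ha h1)
        have : IsNoetherianRing (Localization.AtPrime P) :=
          IsLocalization.isNoetherianRing P.primeCompl _ inferInstance
        exact ((IsDiscreteValuationRing.TFAE (Localization.AtPrime P)
          (IsLocalization.AtPrime.not_isField A hP _)).out 0 1).2 hval }
  infer_instance

theorem IsDedekindDomain.exists_mul_eq {A : Type*} [CommRing A] [IsDedekindDomain A] (m n : A) :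
    ∃ a u v, m * a = n * u ∧ n * (1 - a) = m * v := by
  by_cases hmn : m = 0
  · exact ⟨1, 0, 0, by simp [hmn]⟩
  obtain ⟨I, hI, hmI, hnI⟩ : ∃ I : Ideal A, I = Ideal.span {m} ⊔ Ideal.span {n} ∧
      Ideal.span {m} ≤ I ∧ Ideal.span {n} ≤ I := ⟨_, rfl, le_sup_left, le_sup_right⟩
  obtain ⟨J, hJ⟩ := Ideal.dvd_iff_le.2 hmI
  obtain ⟨K, hK⟩ := Ideal.dvd_iff_le.2 hnI
  have hI0 : I ≠ 0 := by
    rintro rfl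
    rw [zero_mul, Ideal.zero_eq_bot, Ideal.span_singleton_eq_bot] at hJ
    exact hmn hJ
  have hJK : J ⊔ K = ⊤ := by
    apply mul_left_cancel₀ hI0
    rw [Ideal.mul_sup, ← hJ, ← hK, Ideal.mul_top, hI]
  obtain ⟨j, hj, k, hk, hjk⟩ := Submodule.mem_sup.1
    (by rw [hJK]; exact Submodule.mem_top : (1 : A) ∈ J ⊔ K)
  have h1 : m * k ∈ Ideal.span {n} := by
    have := Ideal.mul_mem_mul (Ideal.mem_span_singleton_self m) hk
    rw [hJ, mul_right_comm, ← hK] at this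
    exact Ideal.mul_le_left this
  have h2 : n * j ∈ Ideal.span {m} := by
    have := Ideal.mul_mem_mul (Ideal.mem_span_singleton_self n) hj
    rw [hK, mul_right_comm, ← hJ] at this
    exact Ideal.mul_le_left this
  obtain ⟨u, hu⟩ := Ideal.mem_span_singleton.1 h1
  obtain ⟨v, hv⟩ := Ideal.mem_span_singleton.1 h2
  exact ⟨k, u, v, hu, by rw [← hjk, add_sub_cancel_right, hv]⟩

/-- A ring with commutative multiplication is isomorphic to its opposite. -/
def unopRingEquivOfComm {A : Type*} [Ring A] (h : ∀ x y : A, x * y = y * x) : Aᵐᵒᵖ ≃+* A where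
  __ := MulOpposite.opAddEquiv.symm
  map_mul' x y := h y.unop x.unop

theorem isCommDedekindDomain_of_eq_zero_or_eq_zero {A : Type*} [Ring A] [Nontrivial A]
    [IsNoetherian Aᵐᵒᵖ A] (hE : IsCentrallyEssential A)
    (hC : ∀ m n : A, ∃ a u v, m * a = n * u ∧ n * (1 - a) = m * v)
    (hD : ∀ x y : A, x * y = 0 → x = 0 ∨ y = 0) : IsCommDedekindDomain A := by
  have hcomm := hE.mul_comm_of_eq_zero_or_eq_zero hD
  refine ⟨hcomm, ?_⟩
  have hop : IsNoetherianRing Aᵐᵒᵖ := isNoetherian_of_linearEquiv (opSelfLinearEquiv A)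
  have hN : IsNoetherianRing A := isNoetherianRing_of_ringEquiv Aᵐᵒᵖ (unopRingEquivOfComm hcomm)
  have : NoZeroDivisors A := ⟨fun {a b} => hD a b⟩
  have hdom : IsDomain A := NoZeroDivisors.to_isDomain A
  exact @IsDedekindDomain.of_noetherian_of_exists_mul_eq A (Ring.commRingOfComm A hcomm) hdom hN hC

end Dedekind

theorem isGoodFactor_of_subsingleton (A : Type*) [Ring A] [Subsingleton A] : IsGoodFactor A :=
  Or.inl ⟨⟨fun _ _ => Or.inl (Subsingleton.elim _ _).le,
      fun _ _ => Or.inl (Subsingleton.elim _ _).le⟩,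
    ⟨inferInstance, inferInstance⟩, fun _ ha => (ha (Subsingleton.elim _ _)).elim⟩

/-- An indecomposable right distributive, right Noetherian, centrally essential ring is either
uniserial Artinian or a commutative Dedekind domain. -/
theorem isGoodFactor_of_isIdempotentElem_imp {A : Type*} [Ring A] [IsNoetherian Aᵐᵒᵖ A]
    (hD : IsRightDistributive A) (hE : IsCentrallyEssential A)
    (hI : ∀ e : A, IsIdempotentElem e → e = 0 ∨ e = 1) : IsGoodFactor A := by
  rcases subsingleton_or_nontrivial A with _ | _
  · exact isGoodFactor_of_subsingleton A
  have hC := isRightDistributive_iff.1 hD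
  obtain ⟨z, hz⟩ := hE.exists_isCentralPrimeWitness
  by_cases hzz : z * z = 0
  · obtain ⟨hnil, hunit⟩ := hz.isNilpotent_and_isUnit hC hE hI hzz
    obtain ⟨x, hx, hr, hl⟩ := hz.exists_isNilpotent_generator hC hE hnil hunit
    obtain ⟨h1, h2⟩ := isUniserialRing_and_isArtinianBothSides hx hr hl
    exact Or.inl ⟨h1, h2, hE⟩
  · have h0 : ∀ x, x * z = 0 → x = 0 := fun x hx => hz.eq_zero_of_mul_eq_zero hC hE hI hzz hx
    exact Or.inr (isCommDedekindDomain_of_eq_zero_or_eq_zero hE hC fun x y hxy =>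
      (hz.mul_eq_zero x y (by rw [hxy, zero_mul])).imp (h0 x) (h0 y))

section Decomposition

variable {A : Type*} [Ring A]

/-- A nonzero idempotent with no nontrivial idempotents below it. -/
structure IsPrimitiveIdempotentElem (p : A) : Prop where
  idem : IsIdempotentElem p
  ne_zero : p ≠ 0
  eq_zero_or_eq : ∀ e, IsIdempotentElem e → e * p = e → e = 0 ∨ e = p

/-- The element `e` is the sum of a finite set of orthogonal primitive idempotents. -/
def IsSumOfPrimitives (e : A) : Prop :=
  ∃ S : Finset A, (∀ p ∈ S, IsPrimitiveIdempotentElem p) ∧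
    (∀ p ∈ S, ∀ q ∈ S, p ≠ q → p * q = 0) ∧ ∑ p ∈ S, p = e

theorem mul_sum_eq_self {S : Finset A} (hS : ∀ p ∈ S, IsPrimitiveIdempotentElem p)
    (ho : ∀ p ∈ S, ∀ q ∈ S, p ≠ q → p * q = 0) {p : A} (hp : p ∈ S) :
    p * ∑ q ∈ S, q = p := by
  rw [Finset.mul_sum, Finset.sum_eq_single p (fun q hq h => ho p hp q hq h.symm)
    (fun h => (h hp).elim), (hS p hp).idem.eq]

theorem sum_mul_eq_self {S : Finset A} (hS : ∀ p ∈ S, IsPrimitiveIdempotentElem p)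
    (ho : ∀ p ∈ S, ∀ q ∈ S, p ≠ q → p * q = 0) {p : A} (hp : p ∈ S) :
    (∑ q ∈ S, q) * p = p := by
  rw [Finset.sum_mul, Finset.sum_eq_single p (fun q hq h => ho q hq p hp h)
    (fun h => (h hp).elim), (hS p hp).idem.eq]

theorem IsSumOfPrimitives.add {f g : A} (hf : IsSumOfPrimitives f) (hg : IsSumOfPrimitives g)
    (hfg : f * g = 0) (hgf : g * f = 0) : IsSumOfPrimitives (f + g) := by
  classical
  obtain ⟨S, hS, hSo, rfl⟩ := hf
  obtain ⟨T, hT, hTo, rfl⟩ := hg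
  have h1 : ∀ p ∈ S, ∀ q ∈ T, p * q = 0 := fun p hp q hq => by
    rw [← mul_sum_eq_self hS hSo hp, ← sum_mul_eq_self hT hTo hq, mul_assoc,
      ← mul_assoc _ (∑ q ∈ T, q), hfg, zero_mul, mul_zero]
  have h2 : ∀ p ∈ S, ∀ q ∈ T, q * p = 0 := fun p hp q hq => by
    rw [← sum_mul_eq_self hS hSo hp, ← mul_sum_eq_self hT hTo hq, mul_assoc,
      ← mul_assoc _ (∑ q ∈ S, q), hgf, zero_mul, mul_zero]
  refine ⟨S ∪ T, fun p hp => (Finset.mem_union.1 hp).elim (hS p) (hT p), fun p hp q hq hpq => ?_,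
    Finset.sum_union (Finset.disjoint_left.2 fun p hp hp' =>
      (hS p hp).ne_zero ((hS p hp).idem.eq.symm.trans (h1 p hp p hp')))⟩
  rcases Finset.mem_union.1 hp with hp | hp <;> rcases Finset.mem_union.1 hq with hq | hq
  · exact hSo p hp q hq hpq
  · exact h1 p hp q hq
  · exact h2 q hq p hp
  · exact hTo p hp q hq hpq

theorem IsCentrallyEssential.isSumOfPrimitives [IsNoetherian Aᵐᵒᵖ A] (hE : IsCentrallyEssential A)
    {e : A} (he : IsIdempotentElem e) : IsSumOfPrimitives e := by
  by_contra hbad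
  obtain ⟨e, ⟨he, hbad⟩, hmax⟩ := exists_maximal_right_ideal (rightAnnihilator (A := A))
    (fun e => IsIdempotentElem e ∧ ¬ IsSumOfPrimitives e) ⟨e, he, hbad⟩
  have he0 : e ≠ 0 := fun h => hbad ⟨∅, by simp [h]⟩
  obtain ⟨f, hf, hfe, hf0, hne⟩ : ∃ f, IsIdempotentElem f ∧ f * e = f ∧ f ≠ 0 ∧ f ≠ e := by
    by_contra! h
    refine hbad ⟨{e}, by
      simpa using ⟨he, he0, fun f hf hfe => or_iff_not_imp_left.2 (h f hf hfe)⟩, by simp, by simp⟩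
  have hef : e * f = f := by
    rw [((hE.isMulCentral_of_isIdempotentElem he).comm f).eq, hfe]
  have h1 : (e - f) * f = 0 := by rw [sub_mul, hef, hf.eq, sub_self]
  have h2 : f * (e - f) = 0 := by rw [mul_sub, hfe, hf.eq, sub_self]
  have hg : IsIdempotentElem (e - f) := by
    change (e - f) * (e - f) = e - f
    rw [mul_sub, h1, sub_zero, sub_mul, he.eq, hfe]
  have hfg : ¬ IsSumOfPrimitives f ∨ ¬ IsSumOfPrimitives (e - f) := by
    by_contra! h
    exact hbad (add_sub_cancel f e ▸ h.1.add h.2 h2 h1)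
  rcases hfg with h | h
  · have := hmax f ⟨hf, h⟩ (fun x hx => by
      rw [mem_rightAnnihilator] at *
      rw [← hfe, mul_assoc, hx, mul_zero]) (x := e - f) h2
    rw [mem_rightAnnihilator, mul_sub, he.eq, hef, sub_eq_zero] at this
    exact hne this.symm
  · have := hmax (e - f) ⟨hg, h⟩ (fun x hx => by
      rw [mem_rightAnnihilator] at *
      rw [sub_mul, hx, ← hfe, mul_assoc, hx, mul_zero, sub_zero]) (x := f) h1
    rw [mem_rightAnnihilator, hef] at this
    exact hf0 this

theorem IsPrimitiveIdempotentElem.eq_zero_or_eq_one {p : A} (hp : IsPrimitiveIdempotentElem p)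
    (e : hp.idem.Corner) (he : IsIdempotentElem e) : e = 0 ∨ e = 1 :=
  (hp.eq_zero_or_eq e.1 (congrArg Subtype.val he)
    ((Subsemigroup.mem_corner_iff hp.idem).1 e.2).2).imp Subtype.ext Subtype.ext

end Decomposition

section Product

variable {A : Type*} [Ring A] {ι : Type*} {B : ι → Type*} [∀ i, Ring (B i)]

theorem isRightDistributive_iff_of_ringEquiv_pi (f : A ≃+* ∀ i, B i) :
    IsRightDistributive A ↔ ∀ i, IsRightDistributive (B i) := by
  classical
  simp_rw [isRightDistributive_iff]
  constructor
  · intro h i m n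
    obtain ⟨a, u, v, h1, h2⟩ := h (f.symm (Pi.single i m)) (f.symm (Pi.single i n))
    refine ⟨f a i, f u i, f v i, ?_, ?_⟩
    · simpa using congrFun (congrArg f h1) i
    · simpa using congrFun (congrArg f h2) i
  · intro h m n
    choose a u v h1 h2 using fun i => h i (f m i) (f n i)
    refine ⟨f.symm a, f.symm u, f.symm v, f.injective (funext fun i => ?_),
      f.injective (funext fun i => ?_)⟩
    · simpa using h1 i
    · simpa using h2 i

theorem isCentrallyEssential_iff_of_ringEquiv_pi (f : A ≃+* ∀ i, B i) :
    IsCentrallyEssential A ↔ ∀ i, IsCentrallyEssential (B i) := by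
  classical
  constructor
  · intro h i b hb
    have ha : f.symm (Pi.single i b) ≠ 0 := by simpa using hb
    obtain ⟨c, d, hc, hd, -, hd0, hcd⟩ := h.exists_mul_eq ha
    have key : ∀ c : A, (∀ x, x * c = c * x) → f c i ∈ Set.center (B i) := fun c hc =>
      Semigroup.mem_center_iff.2 fun y => by
        simpa using congrFun (congrArg f (hc (f.symm (Pi.single i y)))) i
    have hd' : f d = Pi.single i b * f c := by rw [← hcd]; simp
    have hi : b * f c i = f d i := by simp [hd']
    have hdi : f d i ≠ 0 := fun h0 => hd0 <| by
      apply f.injective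
      ext j
      by_cases hj : j = i
      · subst hj; simpa using h0
      · simp [hd', hj]
    exact ⟨f c i, f d i, key c hc, key d hd, fun h0 => hdi (by rw [← hi, h0, mul_zero]), hdi, hi⟩
  · intro h a ha
    obtain ⟨i, hi⟩ : ∃ i, f a i ≠ 0 := by
      by_contra! h0
      exact ha (f.injective (by ext i; simpa using h0 i))
    obtain ⟨c, d, hc, hd, hc0, hd0, hcd⟩ := (h i).exists_mul_eq hi
    have key : ∀ c : B i, (∀ x, x * c = c * x) → f.symm (Pi.single i c) ∈ Set.center A :=
      fun c hc => Semigroup.mem_center_iff.2 fun y => f.injective <| by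
        ext j
        by_cases hj : j = i
        · subst hj; simpa using hc (f y j)
        · simp [hj]
    refine ⟨f.symm (Pi.single i c), f.symm (Pi.single i d), key c hc, key d hd, by simpa using hc0,
      by simpa using hd0, f.injective ?_⟩
    ext j
    by_cases hj : j = i
    · subst hj; simpa using hcd
    · simp [hj]

theorem isNoetherian_op_iff_of_ringEquiv_pi [Finite ι] (f : A ≃+* ∀ i, B i) :
    IsNoetherian Aᵐᵒᵖ A ↔ ∀ i, IsNoetherian (B i)ᵐᵒᵖ (B i) := by
  simp_rw [fun R : Type _ => fun [Ring R] => (opSelfLinearEquiv R).isNoetherian_iff]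
  let g : Aᵐᵒᵖ ≃+* ∀ i, (B i)ᵐᵒᵖ := f.op.trans (RingEquiv.piMulOpposite B)
  constructor
  · intro h i
    exact isNoetherianRing_of_surjective Aᵐᵒᵖ _ ((Pi.evalRingHom _ i).comp g.toRingHom)
      ((Function.surjective_eval i).comp g.surjective)
  · intro h
    have : ∀ i, IsNoetherianRing (B i)ᵐᵒᵖ := h
    exact isNoetherianRing_of_ringEquiv _ g.symm

end Product

section GoodFactor

variable {A : Type*} [Ring A]

theorem IsUniserialRing.isRightDistributive (h : IsUniserialRing A) : IsRightDistributive A := by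
  intro I J K
  rcases h.1 J K with hJK | hJK
  · rw [sup_eq_right.2 hJK, sup_eq_right.2 (inf_le_inf_left I hJK)]
  · rw [sup_eq_left.2 hJK, sup_eq_left.2 (inf_le_inf_left I hJK)]

theorem IsCommDedekindDomain.isRightDistributive (h : IsCommDedekindDomain A) :
    IsRightDistributive A := by
  obtain ⟨hcomm, hA⟩ := h
  exact isRightDistributive_iff.2
    (@IsDedekindDomain.exists_mul_eq A (Ring.commRingOfComm A hcomm) hA)

theorem IsCommDedekindDomain.isNoetherian_op (h : IsCommDedekindDomain A) :
    IsNoetherian Aᵐᵒᵖ A := by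
  obtain ⟨hcomm, hA⟩ := h
  have : IsNoetherianRing A :=
    (@IsDedekindDomain.toIsDedekindRing A (Ring.commRingOfComm A hcomm) hA).toIsNoetherian
  exact (opSelfLinearEquiv A).isNoetherian_iff.2
    (isNoetherianRing_of_ringEquiv A (unopRingEquivOfComm hcomm).symm)

theorem IsCommDedekindDomain.isCentrallyEssential (h : IsCommDedekindDomain A) :
    IsCentrallyEssential A := by
  obtain ⟨hcomm, hA⟩ := h
  have : Nontrivial A :=
    (@IsDedekindDomain.toIsDomain A (Ring.commRingOfComm A hcomm) hA).toNontrivial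
  exact fun a ha => ⟨1, a, Set.one_mem_center,
    Semigroup.mem_center_iff.2 fun x => hcomm x a, one_ne_zero, ha, mul_one a⟩

theorem IsArtinianBothSides.isNoetherian_op (h : IsArtinianBothSides A) :
    IsNoetherian Aᵐᵒᵖ A := by
  have : IsArtinianRing Aᵐᵒᵖ := (opSelfLinearEquiv A).isArtinian_iff.1 h.2
  exact (opSelfLinearEquiv A).isNoetherian_iff.2 (inferInstanceAs (IsNoetherianRing Aᵐᵒᵖ))

theorem IsGoodFactor.isRightDistributive (h : IsGoodFactor A) : IsRightDistributive A :=
  h.elim (fun h => h.1.isRightDistributive) (fun h => h.isRightDistributive)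

theorem IsGoodFactor.isNoetherian_op (h : IsGoodFactor A) : IsNoetherian Aᵐᵒᵖ A :=
  h.elim (fun h => h.2.1.isNoetherian_op) (fun h => h.isNoetherian_op)

theorem IsGoodFactor.isCentrallyEssential (h : IsGoodFactor A) : IsCentrallyEssential A :=
  h.elim (fun h => h.2.2) (fun h => h.isCentrallyEssential)

end GoodFactor

/-- A ring `A` is a right distributive, right Noetherian, centrally essential ring if and
only if `A` is isomorphic to a finite direct product `A₁ × ⋯ × Aₙ` of rings, where each
`Aᵢ` is either a uniserial Artinian centrally essential ring or a commutative Dedekind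
domain. -/
theorem rightDistributive_rightNoetherian_centrallyEssential_iff {A : Type u} [Ring A]
    [Nontrivial A] :
    (IsRightDistributive A ∧ IsNoetherian Aᵐᵒᵖ A ∧ IsCentrallyEssential A) ↔
    ∃ (n : ℕ) (B : Fin n → Type u) (instB : ∀ i, Ring (B i)),
      letI := instB
      Nonempty (A ≃+* ∀ i, B i) ∧ ∀ i, IsGoodFactor (B i) := by
  constructor
  · rintro ⟨hD, hN, hE⟩
    obtain ⟨S, hS, hSo, hS1⟩ := hE.isSumOfPrimitives (IsIdempotentElem.one (M := A))
    have he : CompleteOrthogonalIdempotents fun p : S => (p : A) :=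
      { idem := fun p => (hS p p.2).idem
        ortho := fun p q hpq => hSo p p.2 q q.2 (Subtype.coe_ne_coe.2 hpq)
        complete := (Finset.sum_coe_sort S fun p => p).trans hS1 }
    have he' := (CompleteOrthogonalIdempotents.equiv S.equivFin.symm).2 he
    let f := he'.ringEquivOfIsMulCentral fun i =>
      hE.isMulCentral_of_isIdempotentElem (he'.idem i)
    refine ⟨S.card, fun i => (he'.idem i).Corner, inferInstance, ⟨f⟩, fun i => ?_⟩
    have := (isNoetherian_op_iff_of_ringEquiv_pi f).1 hN i
    exact isGoodFactor_of_isIdempotentElem_imp ((isRightDistributive_iff_of_ringEquiv_pi f).1 hD i)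
      ((isCentrallyEssential_iff_of_ringEquiv_pi f).1 hE i)
      (hS _ (S.equivFin.symm i).2).eq_zero_or_eq_one
  · rintro ⟨n, B, _, ⟨f⟩, hB⟩
    exact ⟨(isRightDistributive_iff_of_ringEquiv_pi f).2 fun i => (hB i).isRightDistributive,
      (isNoetherian_op_iff_of_ringEquiv_pi f).2 fun i => (hB i).isNoetherian_op,
      (isCentrallyEssential_iff_of_ringEquiv_pi f).2 fun i => (hB i).isCentrallyEssential⟩
end
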